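/- arXiv:2309.10741 — 4 statements merged into one kernel-verified Lean document; each statement's English description precedes it below -/
import Mathlib

section
/- Let I ⊆ ℂ[x₁,…,xₙ] be a homogeneous prime ideal. Then the sequence of stabilizer groups (G_{[I]_d})_{d∈ℕ} is non-increasing with respect to inclusion: for every d ≥ 1, G_{[I]_d} ⊆ G_{[I]_{d−1}}. -/
noncomputable section
open MvPolynomial

/-- The substitution action of an invertible matrix `g` on polynomials:
`(g · p)(x) = p(g⁻¹ x)`, i.e. each variable `xᵢ` is replaced by the `i`-th entry of `g⁻¹x`. -/
def matAct {n : ℕ} (g : Matrix (Fin n) (Fin n) ℂ) (p : MvPolynomial (Fin n) ℂ) :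
    MvPolynomial (Fin n) ℂ :=
  aeval (fun i => ∑ j, g⁻¹ i j • (X j : MvPolynomial (Fin n) ℂ)) p

/-- The stabilizer (symmetry group) `G_I = {g ∈ GL_n(ℂ) : g·p ∈ I for all p ∈ I}` of an ideal,
realized as the set of invertible matrices that stabilize `I`. -/
def stabIdeal {n : ℕ} (I : Ideal (MvPolynomial (Fin n) ℂ)) :
    Set (Matrix (Fin n) (Fin n) ℂ) :=
  {g | IsUnit g ∧ ∀ p ∈ I, matAct g p ∈ I}
/-- The `d`-th graded component `[I]_d = I ∩ [R]_d`, a complex subspace of `ℂ[x₁,…,xₙ]`. -/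
def gradedComp {n : ℕ} (I : Ideal (MvPolynomial (Fin n) ℂ)) (d : ℕ) :
    Submodule ℂ (MvPolynomial (Fin n) ℂ) :=
  (Submodule.restrictScalars ℂ I) ⊓ homogeneousSubmodule (Fin n) ℂ d
/-- The stabilizer `G_{[I]_d} = {g ∈ GL_n(ℂ) : g·p ∈ [I]_d for all p ∈ [I]_d}`. -/
def stabComp {n : ℕ} (I : Ideal (MvPolynomial (Fin n) ℂ)) (d : ℕ) :
    Set (Matrix (Fin n) (Fin n) ℂ) :=
  {g | IsUnit g ∧ ∀ p ∈ gradedComp I d, matAct g p ∈ gradedComp I d}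

/-- For a homogeneous prime ideal `I`, the sequence of stabilizers
`(G_{[I]_d})_d` is non-increasing: `G_{[I]_d} ⊆ G_{[I]_{d-1}}` for every `d ≥ 1`. -/
theorem stabComp_antitone {n : ℕ} (I : Ideal (MvPolynomial (Fin n) ℂ)) (hprime : I.IsPrime)
    (hhom : ∀ q ∈ I, ∀ e : ℕ, (homogeneousComponent e q : MvPolynomial (Fin n) ℂ) ∈ I) :
    ∀ d : ℕ, 1 ≤ d → stabComp I d ⊆ stabComp I (d - 1) := by
  intro d hd g hg
  obtain ⟨hu, hg⟩ := hg
  refine ⟨hu, fun p hp => ?_⟩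
  obtain ⟨hpI, hph⟩ := hp
  have hpI : p ∈ I := hpI
  have hph : p.IsHomogeneous (d - 1) := hph
  set L : Fin n → MvPolynomial (Fin n) ℂ :=
    fun i => ∑ j, g⁻¹ i j • (X j : MvPolynomial (Fin n) ℂ) with hL
  have hLh : ∀ i, (L i).IsHomogeneous 1 := by
    intro i
    refine IsHomogeneous.sum _ _ _ fun j _ => ?_
    rw [smul_eq_C_mul]
    simpa using (isHomogeneous_C (Fin n) (g⁻¹ i j)).mul (isHomogeneous_X ℂ j)
  have hhomog : (matAct g p).IsHomogeneous (d - 1) := by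
    have := hph.aeval L hLh
    simpa [matAct] using this
  refine ⟨?_, hhomog⟩
  change matAct g p ∈ I
  by_contra hnot
  have hLI : ∀ i, L i ∈ I := by
    intro i
    have h1 : X i * p ∈ gradedComp I d := by
      refine ⟨I.mul_mem_left _ hpI, ?_⟩
      have := (isHomogeneous_X ℂ i).mul hph
      rwa [show 1 + (d - 1) = d by omega] at this
    have h2 : matAct g (X i * p) ∈ I := (hg _ h1).1
    have h3 : matAct g (X i * p) = L i * matAct g p := by
      simp [matAct, hL]
    rw [h3] at h2
    exact (hprime.mem_or_mem h2).resolve_right hnot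
  have hXI : ∀ j, (X j : MvPolynomial (Fin n) ℂ) ∈ I := by
    intro j
    have hmul : g * g⁻¹ = 1 :=
      Matrix.mul_nonsing_inv g ((Matrix.isUnit_iff_isUnit_det g).1 hu)
    have h : (X j : MvPolynomial (Fin n) ℂ) = ∑ k, g j k • L k := by
      simp only [hL, Finset.smul_sum, smul_smul]
      rw [Finset.sum_comm]
      simp only [← Finset.sum_smul, ← Matrix.mul_apply, hmul, Matrix.one_apply]
      simp
    rw [h]
    refine I.sum_mem fun k _ => ?_
    rw [smul_eq_C_mul]
    exact I.mul_mem_left _ (hLI k)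
  have hcomp : (Ideal.Quotient.mkₐ ℂ I).comp (aeval L) = Ideal.Quotient.mkₐ ℂ I := by
    ext i
    simp only [AlgHom.comp_apply, aeval_X, Ideal.Quotient.mkₐ_eq_mk]
    rw [Ideal.Quotient.eq_zero_iff_mem.2 (hLI i), Ideal.Quotient.eq_zero_iff_mem.2 (hXI i)]
  have h := DFunLike.congr_fun hcomp p
  simp only [AlgHom.comp_apply, Ideal.Quotient.mkₐ_eq_mk] at h
  rw [Ideal.Quotient.eq_zero_iff_mem.2 hpI] at h
  exact hnot (Ideal.Quotient.eq_zero_iff_mem.1 h)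
end
end

section
/- Let I ⊆ ℂ[x₁,…,xₙ] be a homogeneous prime ideal generated by homogeneous polynomials p₁,…,p_k of degrees d₁,…,d_k. Then for every d ≥ max{d₁,…,d_k}, the stabilizer G_I of the ideal I equals the stabilizer G_{[I]_d} of its d-th graded component; in particular, G_I is a closed subgroup of GL_n(ℂ) and hence a Lie group. -/
noncomputable section
open MvPolynomial

/-- The substitution as an algebra homomorphism. -/
def matHom {n : ℕ} (M : Matrix (Fin n) (Fin n) ℂ) :
    MvPolynomial (Fin n) ℂ →ₐ[ℂ] MvPolynomial (Fin n) ℂ :=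
  aeval (fun i => ∑ j, M i j • (X j : MvPolynomial (Fin n) ℂ))

lemma matAct_eq {n : ℕ} (g : Matrix (Fin n) (Fin n) ℂ) (p : MvPolynomial (Fin n) ℂ) :
    matAct g p = matHom g⁻¹ p := rfl

lemma matHom_X {n : ℕ} (M : Matrix (Fin n) (Fin n) ℂ) (i : Fin n) :
    matHom M (X i) = ∑ j, M i j • (X j : MvPolynomial (Fin n) ℂ) := by
  simp [matHom]

lemma matHom_one {n : ℕ} (p : MvPolynomial (Fin n) ℂ) :
    matHom (1 : Matrix (Fin n) (Fin n) ℂ) p = p := by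
  have : matHom (1 : Matrix (Fin n) (Fin n) ℂ) = AlgHom.id ℂ _ := by
    apply MvPolynomial.algHom_ext
    intro i
    rw [matHom_X]
    simp [Matrix.one_apply, ite_smul]
  rw [this]; rfl

lemma matHom_mul {n : ℕ} (M N : Matrix (Fin n) (Fin n) ℂ) (p : MvPolynomial (Fin n) ℂ) :
    matHom (M * N) p = matHom N (matHom M p) := by
  have : matHom (M * N) = (matHom N).comp (matHom M) := by
    apply MvPolynomial.algHom_ext
    intro i
    rw [AlgHom.comp_apply, matHom_X, matHom_X, map_sum]
    simp_rw [map_smul, matHom_X, Matrix.mul_apply, Finset.smul_sum, Finset.sum_smul, smul_smul]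
    exact Finset.sum_comm
  rw [this]; rfl

lemma matHom_homog {n d : ℕ} (M : Matrix (Fin n) (Fin n) ℂ) {p : MvPolynomial (Fin n) ℂ}
    (hp : p.IsHomogeneous d) : (matHom M p).IsHomogeneous d := by
  have := hp.aeval (fun i => ∑ j, M i j • (X j : MvPolynomial (Fin n) ℂ)) (n := 1) (by
    intro i
    apply IsHomogeneous.sum
    intro j _
    rw [smul_eq_C_mul]
    exact (isHomogeneous_X ℂ j).C_mul _)
  rw [one_mul] at this
  exact this

lemma matHom_cont {n : ℕ} (p : MvPolynomial (Fin n) ℂ) :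
    ∀ l : MvPolynomial (Fin n) ℂ →ₗ[ℂ] ℂ,
      Continuous (fun M : Matrix (Fin n) (Fin n) ℂ => l (matHom M p)) := by
  induction p using MvPolynomial.induction_on with
  | C a =>
    intro l
    have : ∀ M : Matrix (Fin n) (Fin n) ℂ, matHom M (C a) = C a := fun M => by simp [matHom]
    simp_rw [this]
    exact continuous_const
  | add p q hp hq =>
    intro l
    simp_rw [map_add]
    exact (hp l).add (hq l)
  | mul_X p i hp =>
    intro l
    simp_rw [map_mul, matHom_X, Finset.mul_sum, map_sum, mul_smul_comm, map_smul, smul_eq_mul]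
    refine continuous_finsetSum _ fun j _ => ?_
    refine Continuous.mul (by fun_prop) ?_
    exact hp (l.comp (LinearMap.mulRight ℂ (X j)))

/-- An ideal mapped into itself by an invertible substitution is fixed by it. -/
lemma mem_of_matHom_mem {n : ℕ} (I : Ideal (MvPolynomial (Fin n) ℂ))
    (M N : Matrix (Fin n) (Fin n) ℂ) (hNM : N * M = 1)
    (h : ∀ p ∈ I, matHom M p ∈ I) (p : MvPolynomial (Fin n) ℂ) (hp : matHom M p ∈ I) :
    p ∈ I := by
  have hmono : Monotone (fun m : ℕ => I.comap (matHom (M ^ m))) := by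
    apply monotone_nat_of_le_succ
    intro m q hq
    rw [Ideal.mem_comap] at hq ⊢
    rw [pow_succ, matHom_mul]
    exact h _ hq
  obtain ⟨m, hm⟩ := monotone_stabilizes_iff_noetherian.mpr
    (inferInstance : IsNoetherian (MvPolynomial (Fin n) ℂ) (MvPolynomial (Fin n) ℂ))
    ⟨_, hmono⟩
  have h1 := hm (m + 1) (Nat.le_succ m)
  have hNM' : N ^ m * M ^ m = 1 := by
    rw [← (Commute.mul_pow _), hNM, one_pow]
    rw [Commute, SemiconjBy, hNM, mul_eq_one_comm.mp hNM]
  have h2 : matHom (N ^ m) p ∈ I.comap (matHom (M ^ (m + 1))) := by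
    rw [Ideal.mem_comap, ← matHom_mul, pow_succ, ← mul_assoc, hNM', one_mul]
    exact hp
  have h3 : matHom (N ^ m) p ∈ I.comap (matHom (M ^ m)) := by
    have h1' : I.comap (matHom (M ^ m)) = I.comap (matHom (M ^ (m+1))) := h1
    rw [h1']; exact h2
  rw [Ideal.mem_comap, ← matHom_mul, hNM', matHom_one] at h3
  exact h3

lemma stab_of_comp {n k : ℕ} (p : Fin k → MvPolynomial (Fin n) ℂ)
    (deg : Fin k → ℕ) (hhom : ∀ i, (p i).IsHomogeneous (deg i))
    (I : Ideal (MvPolynomial (Fin n) ℂ)) (hI : I = Ideal.span (Set.range p))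
    (hprime : I.IsPrime) (d : ℕ) (hd : ∀ i, deg i ≤ d)
    (M N : Matrix (Fin n) (Fin n) ℂ) (hNM : N * M = 1)
    (h : ∀ p ∈ gradedComp I d, matHom M p ∈ gradedComp I d) :
    ∀ p ∈ I, matHom M p ∈ I := by
  have hpI : ∀ i, p i ∈ I := fun i => hI ▸ Ideal.subset_span ⟨i, rfl⟩
  have key : ∀ i, matHom M (p i) ∈ I := by
    intro i
    by_contra hcon
    have hX : ∀ j, matHom M (X j) ∈ I := by
      intro j
      have h1 : X j ^ (d - deg i) * p i ∈ gradedComp I d := by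
        refine ⟨I.mul_mem_left _ (hpI i), ?_⟩
        have := (isHomogeneous_X_pow (R := ℂ) j (d - deg i)).mul (hhom i)
        rw [Nat.sub_add_cancel (hd i)] at this
        exact this
      have h2 : matHom M (X j ^ (d - deg i) * p i) ∈ I := (h _ h1).1
      rw [map_mul, map_pow] at h2
      exact hprime.mem_of_pow_mem _ ((hprime.mem_or_mem h2).resolve_right hcon)
    have hX' : ∀ j, (X j : MvPolynomial (Fin n) ℂ) ∈ I := by
      intro j
      have : (X j : MvPolynomial (Fin n) ℂ) = matHom M (matHom N (X j)) := by
        rw [← matHom_mul, hNM, matHom_one]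
      rw [this, matHom_X, map_sum]
      refine I.sum_mem fun k _ => ?_
      rw [map_smul]
      exact Submodule.smul_of_tower_mem I _ (hX k)
    have heq : (Ideal.Quotient.mkₐ ℂ I).comp (matHom M) = Ideal.Quotient.mkₐ ℂ I := by
      apply MvPolynomial.algHom_ext
      intro j
      rw [AlgHom.comp_apply, Ideal.Quotient.mkₐ_eq_mk,
        Ideal.Quotient.eq_zero_iff_mem.mpr (hX j), Ideal.Quotient.eq_zero_iff_mem.mpr (hX' j)]
    have h4 := DFunLike.congr_fun heq (p i)
    rw [AlgHom.comp_apply, Ideal.Quotient.mkₐ_eq_mk,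
      Ideal.Quotient.eq_zero_iff_mem.mpr (hpI i)] at h4
    exact hcon (Ideal.Quotient.eq_zero_iff_mem.mp h4)
  have hle : I ≤ I.comap (matHom M) := by
    conv_lhs => rw [hI]
    rw [Ideal.span_le]
    rintro _ ⟨i, rfl⟩
    exact key i
  exact fun q hq => hle hq

/-- For a homogeneous prime ideal `I = ⟨p₁,…,p_k⟩` with `deg pᵢ = dᵢ` and any
`d ≥ max{d₁,…,d_k}`, one has `G_I = G_{[I]_d}`; in particular `G_I` is a closed subgroup of
`GL_n(ℂ)` (hence a Lie group). -/
theorem stabIdeal_eq_stabComp {n k : ℕ} (p : Fin k → MvPolynomial (Fin n) ℂ)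
    (deg : Fin k → ℕ) (hhom : ∀ i, (p i).IsHomogeneous (deg i))
    (I : Ideal (MvPolynomial (Fin n) ℂ)) (hI : I = Ideal.span (Set.range p))
    (hprime : I.IsPrime) (d : ℕ) (hd : ∀ i, deg i ≤ d) :
    stabIdeal I = stabComp I d ∧
    (1 : Matrix (Fin n) (Fin n) ℂ) ∈ stabIdeal I ∧
    (∀ g h : Matrix (Fin n) (Fin n) ℂ,
      g ∈ stabIdeal I → h ∈ stabIdeal I → g * h ∈ stabIdeal I) ∧
    (∀ g : Matrix (Fin n) (Fin n) ℂ, g ∈ stabIdeal I → g⁻¹ ∈ stabIdeal I) ∧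
    (∀ (u : ℕ → Matrix (Fin n) (Fin n) ℂ) (g : Matrix (Fin n) (Fin n) ℂ),
      (∀ m, u m ∈ stabIdeal I) → Filter.Tendsto u Filter.atTop (nhds g) → IsUnit g →
      g ∈ stabIdeal I) := by
  refine ⟨?_, ?_, ?_, ?_, ?_⟩
  · ext g
    constructor
    · rintro ⟨hg, h⟩
      exact ⟨hg, fun q hq => ⟨h q hq.1, matHom_homog _ hq.2⟩⟩
    · rintro ⟨hg, h⟩
      exact ⟨hg, stab_of_comp p deg hhom I hI hprime d hd g⁻¹ g
        (Matrix.mul_nonsing_inv g ((Matrix.isUnit_iff_isUnit_det g).mp hg)) h⟩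
  · refine ⟨isUnit_one, fun q hq => ?_⟩
    rw [matAct_eq, inv_one, matHom_one]
    exact hq
  · rintro g h ⟨hg, hg'⟩ ⟨hh, hh'⟩
    refine ⟨hg.mul hh, fun q hq => ?_⟩
    rw [matAct_eq, Matrix.mul_inv_rev, matHom_mul]
    exact hg' _ (hh' _ hq)
  · rintro g ⟨hg, hg'⟩
    have hdet := (Matrix.isUnit_iff_isUnit_det g).mp hg
    refine ⟨Matrix.isUnit_nonsing_inv_iff.mpr hg, fun q hq => ?_⟩
    rw [matAct_eq, Matrix.nonsing_inv_nonsing_inv g hdet]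
    refine mem_of_matHom_mem I g⁻¹ g (Matrix.mul_nonsing_inv g hdet) hg' _ ?_
    rw [← matHom_mul, Matrix.mul_nonsing_inv g hdet, matHom_one]
    exact hq
  · intro u g hu hlim hg
    refine ⟨hg, fun q hq => ?_⟩
    have hdet := (Matrix.isUnit_iff_isUnit_det g).mp hg
    by_contra hcon
    obtain ⟨l, hl, hlI⟩ := Submodule.exists_le_ker_of_notMem
      (p := Submodule.restrictScalars ℂ I) (v := matAct g q) hcon
    have hinv : Filter.Tendsto (fun m => (u m)⁻¹) Filter.atTop (nhds g⁻¹) := by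
      simp_rw [Matrix.inv_def, Ring.inverse_eq_inv']
      refine Filter.Tendsto.smul ?_ ?_
      · exact ((continuous_id.matrix_det.tendsto g).comp hlim).inv₀ hdet.ne_zero
      · exact (continuous_id.matrix_adjugate.tendsto g).comp hlim
    have h1 := ((matHom_cont q l).tendsto g⁻¹).comp hinv
    have h2 : ((fun M => l (matHom M q)) ∘ fun m => (u m)⁻¹) = fun _ => 0 := by
      funext m
      exact hlI ((hu m).2 q hq)
    rw [h2] at h1
    exact hl (tendsto_nhds_unique h1 tendsto_const_nhds)
end
end

section
/- In ℂ[x₁,…,x₉], let M be the 3×4 matrix of linear forms with rows (x₁+x₂+x₃+x₄+x₅+x₆, x₁, x₂, x₄), (x₈, x₂+x₃+x₄+x₅+x₆, x₃, x₅), (x₉, x₇, x₄+x₅+x₆, x₆), and let I be the ideal generated by the 2×2 minors of M. Then the symmetry Lie algebra of I, namely { g ∈ M₉(ℂ) : g∗f ∈ [I]₂ for every 2×2 minor f of M }, is a complex vector space of dimension 2. (Since I is prime of dimension 3 > 2, the staged tree model with one stage associated to this caterpillar tree does not have toric vanishing ideal under any linear change of variables, disproving Conjecture 6.8 of Görgen–Maraj–Nicklasson.)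 -/
noncomputable section
open MvPolynomial

/-- The `∗` action of `M_n(ℂ)` on `ℂ[x₁,…,xₙ]`: the derivation with
`g ∗ xᵢ = -∑ⱼ gᵢⱼ xⱼ`, i.e. `g ∗ p = -∑_{i,j} gᵢⱼ xⱼ ∂p/∂xᵢ`. -/
def starAct {n : ℕ} (g : Matrix (Fin n) (Fin n) ℂ) (p : MvPolynomial (Fin n) ℂ) :
    MvPolynomial (Fin n) ℂ :=
  ∑ i, ∑ j, -(g i j) • ((X j : MvPolynomial (Fin n) ℂ) * pderiv i p)

/-- The `3 × 4` matrix of linear forms of the one-stage caterpillar staged tree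
(variables `xᵢ = X (i-1)` in `ℂ[x₁,…,x₉]`). -/
def catMat : Matrix (Fin 3) (Fin 4) (MvPolynomial (Fin 9) ℂ) :=
  !![X 0 + X 1 + X 2 + X 3 + X 4 + X 5, X 0, X 1, X 3;
     X 7, X 1 + X 2 + X 3 + X 4 + X 5, X 2, X 4;
     X 8, X 6, X 3 + X 4 + X 5, X 5]

/-- The set of `2 × 2` minors of `catMat`. -/
def catMinors : Set (MvPolynomial (Fin 9) ℂ) :=
  {q | ∃ (r r' : Fin 3) (c c' : Fin 4), r < r' ∧ c < c' ∧
        q = catMat r c * catMat r' c' - catMat r c' * catMat r' c}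

/-! ### The derivation property of the `∗` action -/

theorem starAct_add_right {n : ℕ} (g : Matrix (Fin n) (Fin n) ℂ) (p q : MvPolynomial (Fin n) ℂ) :
    starAct g (p + q) = starAct g p + starAct g q := by
  simp only [starAct, map_add, mul_add, smul_add, Finset.sum_add_distrib]

theorem starAct_sub_right {n : ℕ} (g : Matrix (Fin n) (Fin n) ℂ) (p q : MvPolynomial (Fin n) ℂ) :
    starAct g (p - q) = starAct g p - starAct g q := by
  simp only [starAct, map_sub, mul_sub, smul_sub, Finset.sum_sub_distrib]

theorem starAct_mul {n : ℕ} (g : Matrix (Fin n) (Fin n) ℂ) (p q : MvPolynomial (Fin n) ℂ) :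
    starAct g (p * q) = starAct g p * q + p * starAct g q := by
  simp only [starAct, Finset.sum_mul, Finset.mul_sum, ← Finset.sum_add_distrib]
  refine Finset.sum_congr rfl fun i _ => Finset.sum_congr rfl fun j _ => ?_
  simp only [Derivation.leibniz, smul_eq_mul, smul_eq_C_mul]
  ring

theorem starAct_X {n : ℕ} (g : Matrix (Fin n) (Fin n) ℂ) (i : Fin n) :
    starAct g (X i) = -∑ j, g i j • (X j : MvPolynomial (Fin n) ℂ) := by
  simp only [starAct, pderiv_X]
  rw [Finset.sum_eq_single i]
  · simp
  · intro b _ hb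
    simp [hb.symm]
  · simp

theorem starAct_add_left {n : ℕ} (g h : Matrix (Fin n) (Fin n) ℂ) (p : MvPolynomial (Fin n) ℂ) :
    starAct (g + h) p = starAct g p + starAct h p := by
  simp only [starAct, ← Finset.sum_add_distrib, Matrix.add_apply, neg_add, add_smul]

theorem starAct_smul_left {n : ℕ} (a : ℂ) (g : Matrix (Fin n) (Fin n) ℂ)
    (p : MvPolynomial (Fin n) ℂ) : starAct (a • g) p = a • starAct g p := by
  simp only [starAct, Finset.smul_sum, Matrix.smul_apply, smul_smul, smul_eq_mul, mul_neg]

/-- The minor of `catMat` on rows `r, r'` and columns `c, c'`. -/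
def minor (r r' : Fin 3) (c c' : Fin 4) : MvPolynomial (Fin 9) ℂ :=
  catMat r c * catMat r' c' - catMat r c' * catMat r' c

theorem minor_mem (r r' : Fin 3) (c c' : Fin 4) :
    minor r r' c c' ∈ Submodule.span ℂ catMinors := by
  have base : ∀ (r r' : Fin 3) (c c' : Fin 4), r < r' → c < c' →
      minor r r' c c' ∈ Submodule.span ℂ catMinors := fun r r' c c' h h' =>
    Submodule.subset_span ⟨r, r', c, c', h, h', rfl⟩
  have rows : ∀ (r r' : Fin 3) (c c' : Fin 4), r < r' →
      minor r r' c c' ∈ Submodule.span ℂ catMinors := by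
    intro r r' c c' h
    rcases lt_trichotomy c c' with h' | h' | h'
    · exact base _ _ _ _ h h'
    · subst h'
      have : minor r r' c c = 0 := by unfold minor; ring
      rw [this]; exact Submodule.zero_mem _
    · have : minor r r' c c' = -minor r r' c' c := by unfold minor; ring
      rw [this]; exact Submodule.neg_mem _ (base _ _ _ _ h h')
  rcases lt_trichotomy r r' with h | h | h
  · exact rows _ _ _ _ h
  · subst h
    have : minor r r c c' = 0 := by unfold minor; ring
    rw [this]; exact Submodule.zero_mem _
  · have : minor r r' c c' = -minor r' r c c' := by unfold minor; ring
    rw [this]; exact Submodule.neg_mem _ (rows _ _ _ _ h)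

/-- The symmetry Lie algebra as a submodule. -/
def symAlg : Submodule ℂ (Matrix (Fin 9) (Fin 9) ℂ) where
  carrier := {g | ∀ f ∈ catMinors, starAct g f ∈ Submodule.span ℂ catMinors}
  add_mem' := by
    intro a b ha hb f hf
    rw [starAct_add_left]
    exact Submodule.add_mem _ (ha f hf) (hb f hf)
  zero_mem' := by
    intro f _
    simp [starAct]
  smul_mem' := by
    intro a g hg f hf
    rw [starAct_smul_left]
    exact Submodule.smul_mem _ _ (hg f hf)

/-- If `g` acts on the matrix `catMat` as `M ↦ -(A M + M B)`, it preserves the span of minors. -/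
theorem mem_symAlg_of_act (g : Matrix (Fin 9) (Fin 9) ℂ) (A : Matrix (Fin 3) (Fin 3) ℂ)
    (B : Matrix (Fin 4) (Fin 4) ℂ)
    (h : ∀ r c, starAct g (catMat r c) =
      -(∑ k, C (A r k) * catMat k c + ∑ k, C (B k c) * catMat r k)) : g ∈ symAlg := by
  rintro f ⟨r, r', c, c', -, -, rfl⟩
  have key : starAct g (catMat r c * catMat r' c' - catMat r c' * catMat r' c) =
      -(∑ k, A r k • minor k r' c c' + ∑ k, A r' k • minor r k c c' +
        ∑ k, B k c • minor r r' k c' + ∑ k, B k c' • minor r r' c k) := by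
    simp only [starAct_sub_right, starAct_mul, h, minor, Fin.sum_univ_three, Fin.sum_univ_four,
      smul_eq_C_mul]
    ring
  rw [key]
  refine Submodule.neg_mem _ (Submodule.add_mem _ (Submodule.add_mem _ (Submodule.add_mem _
    ?_ ?_) ?_) ?_) <;>
  exact Submodule.sum_mem _ fun k _ => Submodule.smul_mem _ _ (minor_mem _ _ _ _)

/-- The nontrivial symmetry. -/
def symP : Matrix (Fin 9) (Fin 9) ℂ :=
  !![1, 0, 0, 0, 0, 0, 0, 0, 0;
     0, 0, 0, 0, 0, 0, 0, 0, 0;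
     0, 0, 0, 0, 0, 0, 0, 0, 0;
     0, 1, 0, -1, 0, 0, 0, 0, 0;
     0, 0, 1, 0, -1, 0, 0, 0, 0;
     0, 0, 0, 2, 2, 1, 0, 0, 0;
     1, 1, 1, 1, 1, 1, 2, 0, 0;
     0, 0, 0, 0, 0, 0, 0, 1, 0;
     1, 1, 1, 1, 1, 1, 0, 1, 2]

theorem symP_mem : symP ∈ symAlg := by
  refine mem_symAlg_of_act symP !![0, 0, 0; 0, 0, 0; 1, 1, 1]
    !![1, 0, 0, 0; 0, 1, 0, 0; 0, 0, 0, 1; 0, 0, 0, -1] ?_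
  intro r c
  have h2 : (C (2 : ℂ) : MvPolynomial (Fin 9) ℂ) = 2 := map_ofNat C 2
  fin_cases r <;> fin_cases c <;>
    simp [catMat, starAct_add_right, starAct_X, symP, h2, Fin.sum_univ_succ, smul_eq_C_mul] <;>
    ring

theorem one_mem_symAlg : (1 : Matrix (Fin 9) (Fin 9) ℂ) ∈ symAlg := by
  refine mem_symAlg_of_act 1 1 0 ?_
  intro r c
  have hX : ∀ i : Fin 9, starAct 1 (X i : MvPolynomial (Fin 9) ℂ) = -X i := by
    intro i
    rw [starAct_X, Finset.sum_eq_single i]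
    · simp
    · intro b _ hb
      simp [hb.symm]
    · simp
  fin_cases r <;> fin_cases c <;>
    simp [catMat, starAct_add_right, hX, Matrix.one_apply] <;>
    ring

/-! ### Tangent conditions at points of the variety -/

/-- The matrix of linear forms evaluated at a vector. -/
def linM (y : Fin 9 → ℂ) : Matrix (Fin 3) (Fin 4) ℂ :=
  !![y 0 + y 1 + y 2 + y 3 + y 4 + y 5, y 0, y 1, y 3;
     y 7, y 1 + y 2 + y 3 + y 4 + y 5, y 2, y 4;
     y 8, y 6, y 3 + y 4 + y 5, y 5]

theorem eval_catMat (p : Fin 9 → ℂ) (r : Fin 3) (c : Fin 4) :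
    eval p (catMat r c) = linM p r c := by
  fin_cases r <;> fin_cases c <;> simp [catMat, linM]

theorem eval_starAct_X (g : Matrix (Fin 9) (Fin 9) ℂ) (p : Fin 9 → ℂ) (i : Fin 9) :
    eval p (starAct g (X i)) = -(g.mulVec p i) := by
  simp [starAct_X, Matrix.mulVec, dotProduct, smul_eq_C_mul]

theorem eval_starAct_catMat (g : Matrix (Fin 9) (Fin 9) ℂ) (p : Fin 9 → ℂ)
    (r : Fin 3) (c : Fin 4) :
    eval p (starAct g (catMat r c)) = -linM (g.mulVec p) r c := by
  fin_cases r <;> fin_cases c <;>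
    simp [catMat, linM, starAct_add_right, eval_starAct_X] <;> ring

/-- A symmetry moves each point of the variety in a tangent direction. -/
theorem tangent (g : Matrix (Fin 9) (Fin 9) ℂ) (hg : g ∈ symAlg) (p : Fin 9 → ℂ)
    (hp : ∀ r r' c c', linM p r c * linM p r' c' - linM p r c' * linM p r' c = 0)
    (r r' : Fin 3) (c c' : Fin 4) (hr : r < r') (hc : c < c') :
    linM (g.mulVec p) r c * linM p r' c' + linM p r c * linM (g.mulVec p) r' c'
      - linM (g.mulVec p) r c' * linM p r' c - linM p r c' * linM (g.mulVec p) r' c = 0 := by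
  have hspan : ∀ f ∈ Submodule.span ℂ catMinors, eval p f = 0 := by
    intro f hf
    induction hf using Submodule.span_induction with
    | mem x hx =>
      obtain ⟨r, r', c, c', -, -, rfl⟩ := hx
      simpa [eval_catMat] using hp r r' c c'
    | zero => simp
    | add x y _ _ hx hy => simp [hx, hy]
    | smul a x _ hx => simp [smul_eq_C_mul, hx]
  have := hspan _ (hg _ ⟨r, r', c, c', hr, hc, rfl⟩)
  simp only [starAct_sub_right, starAct_mul, map_sub, map_add, map_mul, eval_catMat,
    eval_starAct_catMat] at this
  linear_combination -this

/-- The image under `g` of the point read off the rank one matrix `(a, b, c)ᵀ (d, e, f, h)`. -/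
def imageVec (g : Matrix (Fin 9) (Fin 9) ℂ) (a b c d e f h : ℂ) : Fin 9 → ℂ := fun i =>
  g i 0 * (a * e) + g i 1 * (a * f) + g i 2 * (b * f) + g i 3 * (a * h) + g i 4 * (b * h)
    + g i 5 * (c * h) + g i 6 * (c * e) + g i 7 * (b * d) + g i 8 * (c * d)

/-- `tangent` at the point with coordinates read off the rank one matrix
`(a, b, c)ᵀ (d, e, f, h)`; the three hypotheses `h₀ h₁ h₂` say that this matrix has the shape
of `catMat`. -/
theorem tangentAt {g : Matrix (Fin 9) (Fin 9) ℂ} (hg : g ∈ symAlg) (r r' : Fin 3) (k k' : Fin 4)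
    (a b c d e f h : ℂ) (hr : r < r' := by decide) (hk : k < k' := by decide)
    (h₀ : a * d = a * e + a * f + b * f + (a + b + c) * h := by norm_num)
    (h₁ : b * e = a * f + b * f + (a + b + c) * h := by norm_num)
    (h₂ : c * f = (a + b + c) * h := by norm_num) :
    linM (imageVec g a b c d e f h) r k * (![a, b, c] r' * ![d, e, f, h] k')
      + ![a, b, c] r * ![d, e, f, h] k * linM (imageVec g a b c d e f h) r' k'
      - linM (imageVec g a b c d e f h) r k' * (![a, b, c] r' * ![d, e, f, h] k)
      - ![a, b, c] r * ![d, e, f, h] k' * linM (imageVec g a b c d e f h) r' k = 0 := by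
  set p : Fin 9 → ℂ := ![a * e, a * f, b * f, a * h, b * h, c * h, c * e, b * d, c * d] with hpdef
  have hM : ∀ r k, linM p r k = ![a, b, c] r * ![d, e, f, h] k := by
    intro r k
    fin_cases r <;> fin_cases k <;> simp [linM, hpdef]
    · linear_combination -h₀
    · linear_combination -h₁
    · linear_combination -h₂
  have hgy : g.mulVec p = imageVec g a b c d e f h := by
    funext i
    simp [imageVec, Matrix.mulVec, dotProduct, Fin.sum_univ_succ, hpdef]
    ring
  have := tangent g hg p (by intro r r' c c'; simp only [hM]; ring) r r' k k' hr hk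
  rw [hgy] at this
  simpa only [hM] using this

set_option maxHeartbeats 4000000 in
/-- Every symmetry is a combination of `symP` and the identity. -/
theorem eq_of_mem_symAlg (g : Matrix (Fin 9) (Fin 9) ℂ) (hg : g ∈ symAlg) :
    g = (g 0 0 - g 1 1) • symP + g 1 1 • (1 : Matrix (Fin 9) (Fin 9) ℂ) := by
  have t08 : g 0 8 = 0 := by
    have e := tangentAt hg 0 2 0 1 0 0 1 1 0 0 0
    simp only [linM, imageVec, Matrix.of_apply, Matrix.cons_val, mul_zero, zero_mul, add_zero, zero_add,
      mul_one, one_mul, sub_zero] at e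
    linear_combination -e
  have t18 : g 1 8 = 0 := by
    have e := tangentAt hg 0 2 0 2 0 0 1 1 0 0 0
    simp only [linM, imageVec, Matrix.of_apply, Matrix.cons_val, mul_zero, zero_mul, add_zero, zero_add,
      mul_one, one_mul, sub_zero] at e
    linear_combination -e
  have t38 : g 3 8 = 0 := by
    have e := tangentAt hg 0 2 0 3 0 0 1 1 0 0 0
    simp only [linM, imageVec, Matrix.of_apply, Matrix.cons_val, mul_zero, zero_mul, add_zero, zero_add,
      mul_one, one_mul, sub_zero] at e
    linear_combination -e
  have t28 : g 2 8 = 0 := by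
    have e := tangentAt hg 1 2 0 2 0 0 1 1 0 0 0
    simp only [linM, imageVec, Matrix.of_apply, Matrix.cons_val, mul_zero, zero_mul, add_zero, zero_add,
      mul_one, one_mul, sub_zero] at e
    linear_combination -e
  have t48 : g 4 8 = 0 := by
    have e := tangentAt hg 1 2 0 3 0 0 1 1 0 0 0
    simp only [linM, imageVec, Matrix.of_apply, Matrix.cons_val, mul_zero, zero_mul, add_zero, zero_add,
      mul_one, one_mul, sub_zero] at e
    linear_combination -e
  have t07 : g 0 7 = 0 := by
    have e := tangentAt hg 0 1 0 1 0 1 0 1 0 0 0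
    simp only [linM, imageVec, Matrix.of_apply, Matrix.cons_val, mul_zero, zero_mul, add_zero, zero_add,
      mul_one, one_mul, sub_zero] at e
    linear_combination -e
  have t17 : g 1 7 = 0 := by
    have e := tangentAt hg 0 1 0 2 0 1 0 1 0 0 0
    simp only [linM, imageVec, Matrix.of_apply, Matrix.cons_val, mul_zero, zero_mul, add_zero, zero_add,
      mul_one, one_mul, sub_zero] at e
    linear_combination -e
  have t37 : g 3 7 = 0 := by
    have e := tangentAt hg 0 1 0 3 0 1 0 1 0 0 0
    simp only [linM, imageVec, Matrix.of_apply, Matrix.cons_val, mul_zero, zero_mul, add_zero, zero_add,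
      mul_one, one_mul, sub_zero] at e
    linear_combination -e
  have t67 : g 6 7 = 0 := by
    have e := tangentAt hg 1 2 0 1 0 1 0 1 0 0 0
    simp only [linM, imageVec, Matrix.of_apply, Matrix.cons_val, mul_zero, zero_mul, add_zero, zero_add,
      mul_one, one_mul, sub_zero] at e
    linear_combination e
  have t57 : g 5 7 = 0 := by
    have e := tangentAt hg 1 2 0 3 0 1 0 1 0 0 0
    simp only [linM, imageVec, Matrix.of_apply, Matrix.cons_val, mul_zero, zero_mul, add_zero, zero_add,
      mul_one, one_mul, sub_zero] at e
    linear_combination e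
  have t16 : g 1 6 = 0 := by
    have e := tangentAt hg 0 2 1 2 0 0 1 0 1 0 0
    simp only [linM, imageVec, Matrix.of_apply, Matrix.cons_val, mul_zero, zero_mul, add_zero, zero_add,
      mul_one, one_mul, sub_zero] at e
    linear_combination -e
  have t36 : g 3 6 = 0 := by
    have e := tangentAt hg 0 2 1 3 0 0 1 0 1 0 0
    simp only [linM, imageVec, Matrix.of_apply, Matrix.cons_val, mul_zero, zero_mul, add_zero, zero_add,
      mul_one, one_mul, sub_zero] at e
    linear_combination -e
  have t76 : g 7 6 = 0 := by
    have e := tangentAt hg 1 2 0 1 0 0 1 0 1 0 0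
    simp only [linM, imageVec, Matrix.of_apply, Matrix.cons_val, mul_zero, zero_mul, add_zero, zero_add,
      mul_one, one_mul, sub_zero] at e
    linear_combination e
  have t26 : g 2 6 = 0 := by
    have e := tangentAt hg 1 2 1 2 0 0 1 0 1 0 0
    simp only [linM, imageVec, Matrix.of_apply, Matrix.cons_val, mul_zero, zero_mul, add_zero, zero_add,
      mul_one, one_mul, sub_zero] at e
    linear_combination -e
  have t46 : g 4 6 = 0 := by
    have e := tangentAt hg 1 2 1 3 0 0 1 0 1 0 0
    simp only [linM, imageVec, Matrix.of_apply, Matrix.cons_val, mul_zero, zero_mul, add_zero, zero_add,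
      mul_one, one_mul, sub_zero] at e
    linear_combination -e
  have t20 : g 2 0 = 0 := by
    have e := tangentAt hg 0 1 0 2 1 0 0 1 1 0 0
    simp only [linM, imageVec, Matrix.of_apply, Matrix.cons_val, mul_zero, zero_mul, add_zero, zero_add,
      mul_one, one_mul, sub_zero] at e
    linear_combination e
  have t40 : g 4 0 = 0 := by
    have e := tangentAt hg 0 1 0 3 1 0 0 1 1 0 0
    simp only [linM, imageVec, Matrix.of_apply, Matrix.cons_val, mul_zero, zero_mul, add_zero, zero_add,
      mul_one, one_mul, sub_zero] at e
    linear_combination e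
  have t50 : g 5 0 = 0 := by
    have e := tangentAt hg 0 2 0 3 1 0 0 1 1 0 0
    simp only [linM, imageVec, Matrix.of_apply, Matrix.cons_val, mul_zero, zero_mul, add_zero, zero_add,
      mul_one, one_mul, sub_zero] at e
    linear_combination e
  have t47 : g 4 7 = 0 := by
    have e := tangentAt hg 1 2 0 2 0 1 0 1 0 0 0
    simp only [linM, imageVec, Matrix.of_apply, Matrix.cons_val, mul_zero, zero_mul, add_zero, zero_add,
      mul_one, one_mul, sub_zero] at e
    linear_combination e - t37 - t57
  have t30 : g 3 0 = 0 := by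
    have e := tangentAt hg 0 2 0 2 1 0 0 1 1 0 0
    simp only [linM, imageVec, Matrix.of_apply, Matrix.cons_val, mul_zero, zero_mul, add_zero, zero_add,
      mul_one, one_mul, sub_zero] at e
    linear_combination e - t40 - t50
  have t58 : g 5 8 = 0 := by
    have e := tangentAt hg 1 2 0 3 0 1 (-1) 1 0 0 0
    simp only [linM, imageVec, Matrix.of_apply, Matrix.cons_val, mul_zero, zero_mul, add_zero, zero_add,
      mul_one, one_mul, sub_zero] at e
    linear_combination -e - t48 + t57 + t47
  have t56 : g 5 6 = 0 := by
    have e := tangentAt hg 0 2 0 3 1 0 (-1) 1 1 0 0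
    simp only [linM, imageVec, Matrix.of_apply, Matrix.cons_val, mul_zero, zero_mul, add_zero, zero_add,
      mul_one, one_mul, sub_zero] at e
    linear_combination -e - t38 - t36 + t50 + t30 - t58
  have t06 : g 0 6 = 0 := by
    have e := tangentAt hg 0 2 0 1 0 0 1 0 1 0 0
    simp only [linM, imageVec, Matrix.of_apply, Matrix.cons_val, mul_zero, zero_mul, add_zero, zero_add,
      mul_one, one_mul, sub_zero] at e
    linear_combination e - t16 - t36 - t26 - t46 - t56
  have t27 : g 2 7 = 0 := by
    have e := tangentAt hg 1 2 0 2 0 1 (-1) 1 0 0 0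
    simp only [linM, imageVec, Matrix.of_apply, Matrix.cons_val, mul_zero, zero_mul, add_zero, zero_add,
      mul_one, one_mul, sub_zero] at e
    linear_combination e + t38 + t28 + t48 - t37 - t57 - t47 + t58
  have t68 : g 6 8 = 0 := by
    have e := tangentAt hg 1 2 0 1 0 1 (-1) 1 0 0 0
    simp only [linM, imageVec, Matrix.of_apply, Matrix.cons_val, mul_zero, zero_mul, add_zero, zero_add,
      mul_one, one_mul, sub_zero] at e
    linear_combination -e - t18 - t38 - t28 - t48 + t17 + t37 + t67 + t57 + t47 - t58 + t27
  have t78 : g 7 8 = 0 := by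
    have e := tangentAt hg 1 2 0 1 0 0 1 (-1) 1 0 0
    simp only [linM, imageVec, Matrix.of_apply, Matrix.cons_val, mul_zero, zero_mul, add_zero, zero_add,
      mul_one, one_mul, sub_zero] at e
    linear_combination -e - t18 - t38 - t28 - t48 + t16 + t36 + t76 + t26 + t46 - t58 + t56
  have t10 : g 1 0 = 0 := by
    have e := tangentAt hg 0 2 0 2 1 0 (-1) 1 1 0 0
    simp only [linM, imageVec, Matrix.of_apply, Matrix.cons_val, mul_zero, zero_mul, add_zero, zero_add,
      mul_one, one_mul, sub_zero] at e
    linear_combination e + t18 + t38 + t48 + t16 + t36 + t46 - t40 - t50 - t30 + t58 + t56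
  have t70 : g 7 0 = 0 := by
    have e := tangentAt hg 0 1 0 1 1 0 0 1 1 0 0
    simp only [linM, imageVec, Matrix.of_apply, Matrix.cons_val, mul_zero, zero_mul, add_zero, zero_add,
      mul_one, one_mul, sub_zero] at e
    linear_combination -e + t20 + t40 + t50 + t30 + t10
  have t80 : g 8 0 = g 6 0 := by
    have e := tangentAt hg 0 2 0 1 1 0 0 1 1 0 0
    simp only [linM, imageVec, Matrix.of_apply, Matrix.cons_val, mul_zero, zero_mul, add_zero, zero_add,
      mul_one, one_mul, sub_zero] at e
    linear_combination -e
  have t05 : g 0 5 = g 0 4 := by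
    have e := tangentAt hg 0 1 1 3 0 1 (-1) 0 0 0 1
    simp only [linM, imageVec, Matrix.of_apply, Matrix.cons_val, mul_zero, zero_mul, add_zero, zero_add,
      mul_one, one_mul, sub_zero] at e
    linear_combination -e
  have t15 : g 1 5 = g 1 4 := by
    have e := tangentAt hg 0 1 2 3 0 1 (-1) 0 0 0 1
    simp only [linM, imageVec, Matrix.of_apply, Matrix.cons_val, mul_zero, zero_mul, add_zero, zero_add,
      mul_one, one_mul, sub_zero] at e
    linear_combination -e
  have t84 : g 8 4 = g 8 3 := by
    have e := tangentAt hg 0 2 0 3 1 (-1) 0 0 0 0 1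
    simp only [linM, imageVec, Matrix.of_apply, Matrix.cons_val, mul_zero, zero_mul, add_zero, zero_add,
      mul_one, one_mul, sub_zero] at e
    linear_combination e
  have t64 : g 6 4 = g 6 3 := by
    have e := tangentAt hg 0 2 1 3 1 (-1) 0 0 0 0 1
    simp only [linM, imageVec, Matrix.of_apply, Matrix.cons_val, mul_zero, zero_mul, add_zero, zero_add,
      mul_one, one_mul, sub_zero] at e
    linear_combination e
  have t75 : g 7 5 = g 7 3 := by
    have e := tangentAt hg 0 1 0 3 1 0 (-1) 0 0 0 1
    simp only [linM, imageVec, Matrix.of_apply, Matrix.cons_val, mul_zero, zero_mul, add_zero, zero_add,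
      mul_one, one_mul, sub_zero] at e
    linear_combination e
  have t25 : g 2 5 = g 2 3 := by
    have e := tangentAt hg 0 1 2 3 1 0 (-1) 0 0 0 1
    simp only [linM, imageVec, Matrix.of_apply, Matrix.cons_val, mul_zero, zero_mul, add_zero, zero_add,
      mul_one, one_mul, sub_zero] at e
    linear_combination e
  have t82 : g 8 2 = g 8 1 := by
    have e := tangentAt hg 0 2 0 2 1 (-1) 0 0 0 1 0
    simp only [linM, imageVec, Matrix.of_apply, Matrix.cons_val, mul_zero, zero_mul, add_zero, zero_add,
      mul_one, one_mul, sub_zero] at e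
    linear_combination e
  have t62 : g 6 2 = g 6 1 := by
    have e := tangentAt hg 0 2 1 2 1 (-1) 0 0 0 1 0
    simp only [linM, imageVec, Matrix.of_apply, Matrix.cons_val, mul_zero, zero_mul, add_zero, zero_add,
      mul_one, one_mul, sub_zero] at e
    linear_combination e
  have t52 : g 5 2 = g 5 1 := by
    have e := tangentAt hg 0 2 2 3 1 (-1) 0 0 0 1 0
    simp only [linM, imageVec, Matrix.of_apply, Matrix.cons_val, mul_zero, zero_mul, add_zero, zero_add,
      mul_one, one_mul, sub_zero] at e
    linear_combination -e
  have t51 : g 5 1 = 0 := by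
    have e := tangentAt hg 0 2 0 3 1 (-2) 0 (-1) 1 2 0
    simp only [linM, imageVec, Matrix.of_apply, Matrix.cons_val, mul_zero, zero_mul, add_zero, zero_add,
      mul_one, one_mul, sub_zero] at e
    linear_combination 1/2 * e + t57 + 1/2 * t50 - 2 * t52
  have t45 : g 4 5 = g 4 3 := by
    have e := tangentAt hg 0 1 0 3 1 0 (-1) 1 1 0 (-1)
    simp only [linM, imageVec, Matrix.of_apply, Matrix.cons_val, mul_zero, zero_mul, add_zero, zero_add,
      mul_one, one_mul, sub_zero] at e
    linear_combination e + t48 + t76 + t46 - t40 + t78 - t70 - t75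
  have t88 : g 8 8 = g 6 6 - g 8 6 := by
    have e := tangentAt hg 0 2 0 1 1 0 (-1) 1 1 0 0
    simp only [linM, imageVec, Matrix.of_apply, Matrix.cons_val, mul_zero, zero_mul, add_zero, zero_add,
      mul_one, one_mul, sub_zero] at e
    linear_combination e - t18 - t38 - t28 - t48 - t16 - t36 - t26 - t46 + t20 + t40 + t50 +
      t30 - t58 - t56 + t68 + t10 + t80
  have t85 : g 8 5 = -g 7 3 + g 7 4 + g 8 3 := by
    have e := tangentAt hg 1 2 0 3 0 1 (-1) 0 0 0 1
    simp only [linM, imageVec, Matrix.of_apply, Matrix.cons_val, mul_zero, zero_mul, add_zero, zero_add,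
      mul_one, one_mul, sub_zero] at e
    linear_combination e + t84 - t75
  have t24 : g 2 4 = g 1 3 - g 1 4 + g 2 3 := by
    have e := tangentAt hg 0 1 2 3 1 (-1) 0 0 0 0 1
    simp only [linM, imageVec, Matrix.of_apply, Matrix.cons_val, mul_zero, zero_mul, add_zero, zero_add,
      mul_one, one_mul, sub_zero] at e
    linear_combination e
  have t65 : g 6 5 = g 0 3 - g 0 4 + g 6 3 := by
    have e := tangentAt hg 0 2 1 3 1 0 (-1) 0 0 0 1
    simp only [linM, imageVec, Matrix.of_apply, Matrix.cons_val, mul_zero, zero_mul, add_zero, zero_add,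
      mul_one, one_mul, sub_zero] at e
    linear_combination e - t05
  have t42 : g 4 2 = g 3 1 - g 3 2 + g 4 1 := by
    have e := tangentAt hg 0 1 2 3 1 (-1) 0 0 0 1 0
    simp only [linM, imageVec, Matrix.of_apply, Matrix.cons_val, mul_zero, zero_mul, add_zero, zero_add,
      mul_one, one_mul, sub_zero] at e
    linear_combination -e
  have t41 : g 4 1 = -2 * g 3 2 := by
    have e := tangentAt hg 0 1 0 3 1 (-2) 0 (-1) 1 2 0
    simp only [linM, imageVec, Matrix.of_apply, Matrix.cons_val, mul_zero, zero_mul, add_zero, zero_add,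
      mul_one, one_mul, sub_zero] at e
    linear_combination 1/2 * e + 2 * t37 + 1/2 * t40 + t47 + t30 - 2 * t42
  have t32 : g 3 2 = 0 := by
    have e := tangentAt hg 0 1 0 3 2 (-1) 0 1 2 (-2) 0
    simp only [linM, imageVec, Matrix.of_apply, Matrix.cons_val, mul_zero, zero_mul, add_zero, zero_add,
      mul_one, one_mul, sub_zero] at e
    linear_combination 1/6 * e + 1/6 * t37 - 4/3 * t40 + 1/3 * t47 - 2/3 * t30 - 2/3 * t42 +
      2/3 * t41
  have t61 : g 6 1 = 1/2 * g 3 1 + 1/2 * g 6 0 := by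
    have e := tangentAt hg 0 2 1 2 1 (-2) 0 (-1) 1 2 0
    simp only [linM, imageVec, Matrix.of_apply, Matrix.cons_val, mul_zero, zero_mul, add_zero, zero_add,
      mul_one, one_mul, sub_zero] at e
    linear_combination 1/4 * e - 1/2 * t37 + t67 - 1/2 * t57 - 1/4 * t40 - 1/4 * t50 - 1/2 *
      t47 - 1/4 * t30 - 2 * t62 + t52 + 1/2 * t51 + t42 + 1/2 * t41 - t32
  have t60 : g 6 0 = g 3 1 := by
    have e := tangentAt hg 1 2 1 2 2 (-1) 0 1 2 (-2) 0
    simp only [linM, imageVec, Matrix.of_apply, Matrix.cons_val, mul_zero, zero_mul, add_zero, zero_add,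
      mul_one, one_mul, sub_zero] at e
    linear_combination -1/6 * e + 1/3 * t37 + 1/3 * t67 + 1/3 * t57 - 4/3 * t40 - 4/3 * t50 +
      1/3 * t47 - 4/3 * t30 - 2/3 * t62 - 2/3 * t52 + 2/3 * t51 - 2/3 * t42 + 2/3 * t41 - 4/3 *
      t32 + 2/3 * t61
  have t87 : g 8 7 = g 8 1 := by
    have e := tangentAt hg 0 2 0 1 1 (-2) 0 (-1) 1 2 0
    simp only [linM, imageVec, Matrix.of_apply, Matrix.cons_val, mul_zero, zero_mul, add_zero, zero_add,
      mul_one, one_mul, sub_zero] at e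
    linear_combination -1/2 * e - t67 - 1/2 * t80 + 2 * t82 + 2 * t62 + t61 - 1/2 * t60
  have t81 : g 8 1 = g 3 1 := by
    have e := tangentAt hg 1 2 0 1 2 (-1) 0 1 2 (-2) 0
    simp only [linM, imageVec, Matrix.of_apply, Matrix.cons_val, mul_zero, zero_mul, add_zero, zero_add,
      mul_one, one_mul, sub_zero] at e
    linear_combination -1/6 * e + 1/6 * t67 + 4/3 * t80 + 2/3 * t82 - 1/3 * t62 + 1/3 * t61 +
      5/6 * t60 - 1/3 * t87
  have t44 : g 4 4 = g 3 3 - g 3 4 + g 4 3 := by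
    have e := tangentAt hg 0 2 2 3 1 (-1) 0 0 0 1 1
    simp only [linM, imageVec, Matrix.of_apply, Matrix.cons_val, mul_zero, zero_mul, add_zero, zero_add,
      mul_one, one_mul, sub_zero] at e
    linear_combination e - t42
  have t54 : g 5 4 = g 5 3 := by
    have e := tangentAt hg 0 2 2 3 1 (-1) 0 0 0 0 1
    simp only [linM, imageVec, Matrix.of_apply, Matrix.cons_val, mul_zero, zero_mul, add_zero, zero_add,
      mul_one, one_mul, sub_zero] at e
    linear_combination e - t44
  have t04 : g 0 4 = g 0 3 := by
    have e := tangentAt hg 0 1 1 3 1 (-1) 0 0 0 0 1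
    simp only [linM, imageVec, Matrix.of_apply, Matrix.cons_val, mul_zero, zero_mul, add_zero, zero_add,
      mul_one, one_mul, sub_zero] at e
    linear_combination e - t24 - t44 - t54
  have t74 : g 7 4 = g 7 3 := by
    have e := tangentAt hg 0 1 0 3 1 (-1) 0 0 0 0 1
    simp only [linM, imageVec, Matrix.of_apply, Matrix.cons_val, mul_zero, zero_mul, add_zero, zero_add,
      mul_one, one_mul, sub_zero] at e
    linear_combination e - t24 - t44 - t54 - t04
  have t22 : g 2 2 = g 1 1 - g 1 2 + g 2 1 := by
    have e := tangentAt hg 0 1 2 3 (-1) 1 0 0 0 (-1) 1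
    simp only [linM, imageVec, Matrix.of_apply, Matrix.cons_val, mul_zero, zero_mul, add_zero, zero_add,
      mul_one, one_mul, sub_zero] at e
    linear_combination -e + t24 - t42 + t44
  have t02 : g 0 2 = g 0 1 := by
    have e := tangentAt hg 0 1 1 2 1 (-1) 0 0 0 1 0
    simp only [linM, imageVec, Matrix.of_apply, Matrix.cons_val, mul_zero, zero_mul, add_zero, zero_add,
      mul_one, one_mul, sub_zero] at e
    linear_combination e - t52 - t42 - t22
  have t72 : g 7 2 = g 7 1 := by
    have e := tangentAt hg 0 1 0 2 1 (-1) 0 0 0 1 0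
    simp only [linM, imageVec, Matrix.of_apply, Matrix.cons_val, mul_zero, zero_mul, add_zero, zero_add,
      mul_one, one_mul, sub_zero] at e
    linear_combination e - t52 - t42 - t22 - t02
  have t77 : g 7 7 = g 0 0 - 1/2 * g 0 1 - 2 * g 7 1 := by
    have e := tangentAt hg 0 1 0 1 2 (-1) 0 1 2 (-2) 0
    simp only [linM, imageVec, Matrix.of_apply, Matrix.cons_val, mul_zero, zero_mul, add_zero, zero_add,
      mul_one, one_mul, sub_zero] at e
    linear_combination 1/4 * e - 1/4 * t07 + 4 * t70 + 1/2 * t02 + 2 * t72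
  have t86 : g 8 6 = -g 3 1 + g 7 3 + g 8 3 := by
    have e := tangentAt hg 1 2 0 1 (-1) 1 (-1) 0 (-1) 1 1
    simp only [linM, imageVec, Matrix.of_apply, Matrix.cons_val, mul_zero, zero_mul, add_zero, zero_add,
      mul_one, one_mul, sub_zero] at e
    linear_combination e - t76 - t70 - t80 - t84 + t75 - t82 + t85 - t60 - t72
  have t83 : g 8 3 = g 3 1 := by
    have e := tangentAt hg 1 2 0 1 1 (-1) (-1) 0 1 1 1
    simp only [linM, imageVec, Matrix.of_apply, Matrix.cons_val, mul_zero, zero_mul, add_zero, zero_add,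
      mul_one, one_mul, sub_zero] at e
    linear_combination -1/2 * e + 1/2 * t76 - 1/2 * t70 + 1/2 * t80 - 1/2 * t84 + 1/2 * t75 -
      1/2 * t82 - 1/2 * t85 + 1/2 * t60 + 1/2 * t72 - 1/2 * t86
  have t43 : g 4 3 = g 1 4 + g 2 3 - g 3 5 := by
    have e := tangentAt hg 0 1 2 3 (-1) 1 (-1) 0 (-1) 1 1
    simp only [linM, imageVec, Matrix.of_apply, Matrix.cons_val, mul_zero, zero_mul, add_zero, zero_add,
      mul_one, one_mul, sub_zero] at e
    linear_combination e - t16 + t36 - t26 + t46 - t20 + t40 + t30 - t10 + t15 + t25 - t45 -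
      t24 + t42 + t44 - t22
  have t55 : g 5 5 = g 0 0 - g 0 3 := by
    have e := tangentAt hg 0 1 1 2 1 (-1) (-2) 0 2 1 1
    simp only [linM, imageVec, Matrix.of_apply, Matrix.cons_val, mul_zero, zero_mul, add_zero, zero_add,
      mul_one, one_mul, sub_zero] at e
    linear_combination 1/2 * e + 2 * t16 - 2 * t36 + 2 * t26 - 2 * t46 - t20 + t40 + t50 + t30
      - 2 * t56 - 2 * t06 - t10 - t05 + t15 + t25 - 1/2 * t52 - t45 + 1/2 * t24 - 1/2 * t42 -
      1/2 * t44 - 1/2 * t54 - 3/2 * t04 + 1/2 * t22 - 1/2 * t02 - t43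
  have t23 : g 2 3 = -g 1 4 := by
    have e := tangentAt hg 0 1 1 2 1 (-1) (-1) 0 1 1 1
    simp only [linM, imageVec, Matrix.of_apply, Matrix.cons_val, mul_zero, zero_mul, add_zero, zero_add,
      mul_one, one_mul, sub_zero] at e
    linear_combination e - t36 - t46 + t40 + t50 + t30 - t56 - t06 - t05 - t52 - t45 - t42 -
      t44 - t54 - 2 * t04 - t02 - t43 - t55
  have t73 : g 7 3 = 0 := by
    have e := tangentAt hg 0 1 0 1 (-1) 1 (-1) 0 (-1) 1 1
    simp only [linM, imageVec, Matrix.of_apply, Matrix.cons_val, mul_zero, zero_mul, add_zero, zero_add,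
      mul_one, one_mul, sub_zero] at e
    linear_combination e + t16 + t36 + t76 + t26 + t46 + t20 + t40 + t50 + t30 + t56 + t06 +
      t10 + t70 - t05 - t15 - t75 - t25 + t52 - t45 + t24 + t42 + t44 + t54 + t74 + t22 + t02 +
      t72 - t43 - t55 - 2 * t23
  have t34 : g 3 4 = g 1 2 - g 1 4 - g 2 1 := by
    have e := tangentAt hg 0 1 2 3 1 1 (-1) 2 1 1 (-1)
    simp only [linM, imageVec, Matrix.of_apply, Matrix.cons_val, mul_zero, zero_mul, add_zero, zero_add,
      mul_one, one_mul, sub_zero] at e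
    linear_combination 1/2 * e - t18 - t38 + t28 + t48 + t17 + t37 - 1/2 * t16 - 1/2 * t36 +
      1/2 * t26 + 1/2 * t46 - 1/2 * t20 - 1/2 * t40 - t47 + 1/2 * t30 - t27 + 1/2 * t10 + 1/2 *
      t15 - 1/2 * t25 - 1/2 * t45 + 1/2 * t24 - 1/2 * t42 - t41 + 3 * t32 + 1/2 * t44 - 1/2 *
      t22 + 1/2 * t43 + t23
  have t21 : g 2 1 = -g 1 4 := by
    have e := tangentAt hg 0 1 2 3 1 (-2) (-1) (-2) 2 2 1
    simp only [linM, imageVec, Matrix.of_apply, Matrix.cons_val, mul_zero, zero_mul, add_zero, zero_add,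
      mul_one, one_mul, sub_zero] at e
    linear_combination 1/6 * e + 2/3 * t18 - 4/3 * t38 + 1/3 * t28 - 2/3 * t48 + 4/3 * t17 -
      8/3 * t37 - 2/3 * t16 + 4/3 * t36 - 1/3 * t26 + 2/3 * t46 + 1/3 * t20 - 2/3 * t40 - 4/3 *
      t47 - 4/3 * t30 + 2/3 * t27 + 2/3 * t10 - 1/3 * t15 - 1/6 * t25 + 1/3 * t45 - 1/3 * t24 +
      4/3 * t42 + 2/3 * t41 + 2/3 * t44 - 2/3 * t22 + 2/3 * t43 + 1/3 * t23 + 2/3 * t34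
  have t35 : g 3 5 = g 1 1 + g 1 3 - g 3 1 - g 3 3 := by
    have e := tangentAt hg 1 2 2 3 (-1) 1 (-1) 0 (-1) 1 1
    simp only [linM, imageVec, Matrix.of_apply, Matrix.cons_val, mul_zero, zero_mul, add_zero, zero_add,
      mul_one, one_mul, sub_zero] at e
    linear_combination e + t36 + t26 + t20 + t30 - t25 + t24 + t32 + t22 - t23 + t34 - t21
  have t33 : g 3 3 = g 1 1 + g 1 3 - g 1 4 - g 3 1 := by
    have e := tangentAt hg 0 2 2 3 1 (-1) (-1) 0 1 1 1
    simp only [linM, imageVec, Matrix.of_apply, Matrix.cons_val, mul_zero, zero_mul, add_zero, zero_add,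
      mul_one, one_mul, sub_zero] at e
    linear_combination 1/2 * e - 1/2 * t16 - 1/2 * t46 + 1/2 * t40 + 1/2 * t10 - 1/2 * t15 -
      1/2 * t45 - 1/2 * t42 + 1/2 * t32 - 1/2 * t44 - 1/2 * t43 - 1/2 * t23 + 1/2 * t34 - 1/2 *
      t21 + 1/2 * t35
  have t66 : g 6 6 = g 0 0 + g 1 3 - g 1 4 + g 3 1 := by
    have e := tangentAt hg 0 2 0 3 1 0 (-1) 1 1 0 1
    simp only [linM, imageVec, Matrix.of_apply, Matrix.cons_val, mul_zero, zero_mul, add_zero, zero_add,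
      mul_one, one_mul, sub_zero] at e
    linear_combination e - t08 - t18 - t28 - t48 - t16 - t26 - t46 + t20 + t40 - t06 + t10 +
      t80 - t05 - t15 - t25 - t45 - t88 - t85 + t60 - t04 - t74
  have t31 : g 3 1 = g 0 0 - 2 * g 0 1 - g 1 1 + g 1 2 + 1/2 * g 1 4 := by
    have e := tangentAt hg 0 1 1 2 1 (-2) 0 (-1) 1 2 0
    simp only [linM, imageVec, Matrix.of_apply, Matrix.cons_val, mul_zero, zero_mul, add_zero, zero_add,
      mul_one, one_mul, sub_zero] at e
    linear_combination 1/4 * e + 2 * t07 + t37 + t57 + 1/4 * t20 + 1/2 * t40 + 1/2 * t50 + t47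
      + 1/2 * t30 + 1/2 * t27 - 2 * t52 - t51 - 2 * t42 - t41 + 2 * t32 - t22 - 4 * t02 - 1/2 *
      t21
  have t14 : g 1 4 = -g 0 1 + g 1 2 := by
    have e := tangentAt hg 0 1 1 2 2 (-1) 0 1 2 (-2) 0
    simp only [linM, imageVec, Matrix.of_apply, Matrix.cons_val, mul_zero, zero_mul, add_zero, zero_add,
      mul_one, one_mul, sub_zero] at e
    linear_combination 1/12 * e + 1/6 * t07 + 1/2 * t17 + 1/3 * t37 + 1/3 * t57 - 8/3 * t20 -
      4/3 * t40 - 4/3 * t50 + 1/3 * t47 - 4/3 * t30 + 2/3 * t27 - 2 * t10 - 2/3 * t52 + 2/3 *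
      t51 - 2/3 * t42 + 2/3 * t41 - 4/3 * t32 - 4/3 * t22 - 1/3 * t02 + 4/3 * t21 + 2/3 * t31
  have t71 : g 7 1 = -1/2 * g 1 2 := by
    have e := tangentAt hg 0 1 0 1 1 (-2) 0 (-1) 1 2 0
    simp only [linM, imageVec, Matrix.of_apply, Matrix.cons_val, mul_zero, zero_mul, add_zero, zero_add,
      mul_one, one_mul, sub_zero] at e
    linear_combination 1/6 * e + 4/3 * t07 + t17 + t37 + t57 + 1/2 * t20 + 1/2 * t40 + 1/2 *
      t50 + t47 + 1/2 * t30 + t27 + 1/2 * t10 + 1/6 * t70 - 2 * t52 - t51 - 2 * t42 - t41 + 2 *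
      t32 - 2 * t22 - 8/3 * t02 - 2/3 * t72 + 1/3 * t77 - t21 - t31 + 1/2 * t14
  have t53 : g 5 3 = 2 * g 0 0 - 9/2 * g 0 1 - 2 * g 1 1 + 7/2 * g 1 2 := by
    have e := tangentAt hg 0 2 0 2 1 1 (-1) 2 1 1 (-1)
    simp only [linM, imageVec, Matrix.of_apply, Matrix.cons_val, mul_zero, zero_mul, add_zero, zero_add,
      mul_one, one_mul, sub_zero] at e
    linear_combination -1/2 * e + t08 - t18 - t38 + t28 - t48 - t07 + t17 + t37 + t57 - 1/2 *
      t16 - 1/2 * t36 + 1/2 * t26 - 1/2 * t46 - 1/2 * t20 + 1/2 * t40 + 1/2 * t50 + t47 + 1/2 *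
      t30 - t58 - 1/2 * t56 + 1/2 * t06 - t27 + 1/2 * t10 - 1/2 * t80 - 1/2 * t05 + 1/2 * t15 +
      1/2 * t84 - 1/2 * t25 - 1/2 * t82 + 1/2 * t52 + t51 + 1/2 * t45 + t88 - 1/2 * t85 + 1/2 *
      t24 + 1/2 * t42 + t41 - 2 * t32 - 1/2 * t60 - t87 - 2 * t81 - 1/2 * t44 - 1/2 * t54 - 1/2
      * t74 - 1/2 * t22 - 1/2 * t02 - 1/2 * t86 - 1/2 * t43 + 1/2 * t55 - 1/2 * t73 - t21 + t35
      - 2 * t33 + t66 + t31 + 3/2 * t14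
  have t12 : g 1 2 = 0 := by
    have e := tangentAt hg 0 2 0 2 1 (-2) (-1) (-2) 2 2 1
    simp only [linM, imageVec, Matrix.of_apply, Matrix.cons_val, mul_zero, zero_mul, add_zero, zero_add,
      mul_one, one_mul, sub_zero] at e
    linear_combination 1/12 * e + 1/3 * t08 + 2/3 * t18 + 2/3 * t38 + 1/3 * t28 + 2/3 * t48 +
      2/3 * t07 + 4/3 * t17 + 4/3 * t37 + 4/3 * t57 - 2/3 * t16 - 2/3 * t36 - 1/3 * t26 - 2/3 *
      t46 + 1/3 * t20 + 2/3 * t40 + 2/3 * t50 + 4/3 * t47 + 2/3 * t30 + 2/3 * t58 - 2/3 * t56 -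
      1/3 * t06 + 2/3 * t27 + 2/3 * t10 + 1/3 * t80 - 1/6 * t05 - 1/3 * t15 - 1/3 * t84 - 1/6 *
      t25 - 2/3 * t82 - 4/3 * t52 - 2/3 * t51 - 1/3 * t45 + 1/3 * t88 - 1/6 * t85 - 1/3 * t24 -
      4/3 * t42 - 2/3 * t41 + 4/3 * t32 + 1/3 * t60 + 2/3 * t87 + 1/3 * t81 - 2/3 * t44 - 2/3 *
      t54 - 1/2 * t04 - 1/6 * t74 - 2/3 * t22 - 2/3 * t02 - 2/3 * t86 - t83 - 2/3 * t43 - 1/3 *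
      t55 - t23 - 2/3 * t73 - 1/3 * t21 + 1/3 * t35 - 2/3 * t33 + 1/3 * t66 + 1/3 * t31 + 1/2 *
      t14 - 1/3 * t53
  have t13 : g 1 3 = -1/2 * g 0 3 := by
    have e := tangentAt hg 0 1 0 3 0 1 (-1) 1 0 0 1
    simp only [linM, imageVec, Matrix.of_apply, Matrix.cons_val, mul_zero, zero_mul, add_zero, zero_add,
      mul_one, one_mul, sub_zero] at e
    linear_combination 1/2 * e + 1/2 * t08 + 1/2 * t18 + 1/2 * t28 + 1/2 * t48 - 1/2 * t07 -
      1/2 * t17 - 1/2 * t57 - 1/2 * t47 + 1/2 * t58 - 1/2 * t27 + 1/2 * t05 + 1/2 * t15 + 1/2 *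
      t25 + 1/2 * t45 - 1/2 * t24 - 1/2 * t44 - 1/2 * t54 + 1/2 * t55 + 1/2 * t34 - 1/2 * t21 -
      1/2 * t33 + 1/2 * t31 + 5/4 * t14 - 1/2 * t53 + 1/2 * t12
  have t01 : g 0 1 = 0 := by
    have e := tangentAt hg 1 2 2 3 0 1 (-1) 0 0 0 1
    simp only [linM, imageVec, Matrix.of_apply, Matrix.cons_val, mul_zero, zero_mul, add_zero, zero_add,
      mul_one, one_mul, sub_zero] at e
    linear_combination -e + t25 + t45 - t24 - t44 - t54 + t55 + t35 - 2 * t33 + t31 + 7/2 * t14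
      - t53 + t12 - 2 * t13
  have t03 : g 0 3 = 0 := by
    have e := tangentAt hg 0 1 1 2 1 1 (-1) 2 1 1 (-1)
    simp only [linM, imageVec, Matrix.of_apply, Matrix.cons_val, mul_zero, zero_mul, add_zero, zero_add,
      mul_one, one_mul, sub_zero] at e
    linear_combination -1/2 * e - t08 + 2 * t18 + t38 + t48 + t07 - 2 * t17 - t37 - t57 + t16 +
      1/2 * t36 + 1/2 * t46 - 1/2 * t40 - 1/2 * t50 - t47 - 1/2 * t30 + t58 + 1/2 * t56 - 1/2 *
      t06 - t10 + 1/2 * t05 - t15 - 1/2 * t52 - t51 - 1/2 * t45 - 1/2 * t42 - t41 + 2 * t32 +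
      1/2 * t44 + 1/2 * t54 + 1/2 * t02 + 1/2 * t43 - 1/2 * t55 + 1/2 * t23 - t35 + 2 * t33 - 2
      * t31 - 3 * t14 + t53 - 5/2 * t12 + 2 * t13 + 7/2 * t01
  have t63 : g 6 3 = g 0 0 - g 1 1 := by
    have e := tangentAt hg 1 2 1 2 1 1 (-1) 2 1 1 (-1)
    simp only [linM, imageVec, Matrix.of_apply, Matrix.cons_val, mul_zero, zero_mul, add_zero, zero_add,
      mul_one, one_mul, sub_zero] at e
    linear_combination e - 2 * t18 + 2 * t17 + 2 * t67 - t16 - 2 * t68 + t10 + t15 - t64 + t62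
      + t65 + 2 * t61 + 2 * t60 - t04 - t66 + 2 * t31 + 2 * t14 + 5 * t12 - 2 * t13 - 6 * t01 +
      t03
  have f13 : g 1 3 = 0 := by
    linear_combination t13 - 1/2 * t03
  have f53 : g 5 3 = 2 * g 0 0 - 2 * g 1 1 := by
    linear_combination t53 - 9/2 * t01 + 7/2 * t12
  have f71 : g 7 1 = 0 := by
    linear_combination t71 - 1/2 * t12
  have f14 : g 1 4 = 0 := by
    linear_combination t14 - t01 + t12
  have f31 : g 3 1 = g 0 0 - g 1 1 := by
    linear_combination t31 - 2 * t01 + t12 + 1/2 * f14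
  have f66 : g 6 6 = 2 * g 0 0 - g 1 1 := by
    linear_combination t66 + f13 - f14 + f31
  have f33 : g 3 3 = -g 0 0 + 2 * g 1 1 := by
    linear_combination t33 + f13 - f14 - f31
  have f35 : g 3 5 = 0 := by
    linear_combination t35 - f31 - f33 + f13
  have f21 : g 2 1 = 0 := by
    linear_combination t21 - f14
  have f34 : g 3 4 = 0 := by
    linear_combination t34 + t12 - f21 - f14
  have f23 : g 2 3 = 0 := by
    linear_combination t23 - f14
  have f55 : g 5 5 = g 0 0 := by
    linear_combination t55 - t03
  have f43 : g 4 3 = 0 := by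
    linear_combination t43 - f35 + f23 + f14
  have f83 : g 8 3 = g 0 0 - g 1 1 := by
    linear_combination t83 + f31
  have f86 : g 8 6 = 0 := by
    linear_combination t86 + t73 + f83 - f31
  have f77 : g 7 7 = g 0 0 := by
    linear_combination t77 - 1/2 * t01 - 2 * f71
  have f72 : g 7 2 = 0 := by
    linear_combination t72 + f71
  have f02 : g 0 2 = 0 := by
    linear_combination t02 + t01
  have f22 : g 2 2 = g 1 1 := by
    linear_combination t22 - t12 + f21
  have f74 : g 7 4 = 0 := by
    linear_combination t74 + t73
  have f04 : g 0 4 = 0 := by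
    linear_combination t04 + t03
  have f54 : g 5 4 = 2 * g 0 0 - 2 * g 1 1 := by
    linear_combination t54 + f53
  have f44 : g 4 4 = -g 0 0 + 2 * g 1 1 := by
    linear_combination t44 + f33 - f34 + f43
  have f81 : g 8 1 = g 0 0 - g 1 1 := by
    linear_combination t81 + f31
  have f87 : g 8 7 = g 0 0 - g 1 1 := by
    linear_combination t87 + f81
  have f60 : g 6 0 = g 0 0 - g 1 1 := by
    linear_combination t60 + f31
  have f61 : g 6 1 = g 0 0 - g 1 1 := by
    linear_combination t61 + 1/2 * f31 + 1/2 * f60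
  have f41 : g 4 1 = 0 := by
    linear_combination t41 - 2 * t32
  have f42 : g 4 2 = g 0 0 - g 1 1 := by
    linear_combination t42 + f41 + f31 - t32
  have f65 : g 6 5 = g 0 0 - g 1 1 := by
    linear_combination t65 + t03 + t63 - f04
  have f24 : g 2 4 = 0 := by
    linear_combination t24 + f13 - f14 + f23
  have f85 : g 8 5 = g 0 0 - g 1 1 := by
    linear_combination t85 + f74 + f83 - t73
  have f88 : g 8 8 = 2 * g 0 0 - g 1 1 := by
    linear_combination t88 + f66 - f86
  have f45 : g 4 5 = 0 := by
    linear_combination t45 + f43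
  have f52 : g 5 2 = 0 := by
    linear_combination t52 + t51
  have f62 : g 6 2 = g 0 0 - g 1 1 := by
    linear_combination t62 + f61
  have f82 : g 8 2 = g 0 0 - g 1 1 := by
    linear_combination t82 + f81
  have f25 : g 2 5 = 0 := by
    linear_combination t25 + f23
  have f75 : g 7 5 = 0 := by
    linear_combination t75 + t73
  have f64 : g 6 4 = g 0 0 - g 1 1 := by
    linear_combination t64 + t63
  have f84 : g 8 4 = g 0 0 - g 1 1 := by
    linear_combination t84 + f83
  have f15 : g 1 5 = 0 := by
    linear_combination t15 + f14
  have f05 : g 0 5 = 0 := by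
    linear_combination t05 + f04
  have f80 : g 8 0 = g 0 0 - g 1 1 := by
    linear_combination t80 + f60
  ext i j
  fin_cases i <;> fin_cases j <;>
    simp [symP, t01, f02, t03, f04, f05, t06, t07, t08, t10, t12, f13, f14, f15, t16, t17, t18,
      t20, f21, f22, f23, f24, f25, t26, t27, t28, t30, f31, t32, f33, f34, f35, t36, t37, t38,
      t40, f41, f42, f43, f44, f45, t46, t47, t48, t50, t51, f52, f53, f54, f55, t56, t57, t58,
      f60, f61, f62, t63, f64, f65, f66, t67, t68, t70, f71, f72, t73, f74, f75, t76, f77, t78,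
      f80, f81, f82, f83, f84, f85, f86, f87, f88] <;>
    ring

/-- The symmetry Lie algebra
`{g ∈ M₉(ℂ) : g ∗ f ∈ [I]₂ for every 2×2 minor f of catMat}` of the ideal `I` of `2 × 2`
minors (with `[I]₂` the complex span of the minors) is a complex vector space of dimension `2`. -/
theorem caterpillar_lieAlg_dim_two :
    ∃ W : Submodule ℂ (Matrix (Fin 9) (Fin 9) ℂ),
      (W : Set (Matrix (Fin 9) (Fin 9) ℂ)) =
        {g | ∀ f ∈ catMinors, starAct g f ∈ Submodule.span ℂ catMinors} ∧
      Module.finrank ℂ W = 2 := by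
  refine ⟨symAlg, rfl, ?_⟩
  have hspan : symAlg = Submodule.span ℂ (Set.range ![symP, 1]) := by
    apply le_antisymm
    · intro g hg
      rw [eq_of_mem_symAlg g hg]
      refine Submodule.add_mem _ (Submodule.smul_mem _ _ (Submodule.subset_span ⟨0, rfl⟩))
        (Submodule.smul_mem _ _ (Submodule.subset_span ⟨1, rfl⟩))
    · rw [Submodule.span_le]
      rintro _ ⟨i, rfl⟩
      fin_cases i
      · exact symP_mem
      · exact one_mem_symAlg
  have hli : LinearIndependent ℂ ![symP, 1] := by
    rw [LinearIndependent.pair_iff]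
    intro s t h
    have h0 := congrFun (congrFun h 0) 0
    have h1 := congrFun (congrFun h 1) 1
    simp [symP] at h0 h1
    subst h1
    simpa using h0
  rw [hspan, finrank_span_eq_card hli]
  simp
end
end

section
/- In the polynomial ring ℂ[σ₁₁,σ₁₂,σ₁₃,σ₁₄,σ₂₂,σ₂₃,σ₂₄,σ₃₃,σ₃₄,σ₄₄] in 10 variables, let p₁ = σ₂₃σ₁₄σ₂₄ − σ₁₃σ₂₄² − σ₂₂σ₁₄σ₃₄ + σ₁₂σ₂₄σ₃₄ + σ₂₂σ₁₃σ₄₄ − σ₁₂σ₂₃σ₄₄ and p₂ = σ₁₃σ₂₃σ₁₄ − σ₂₄σ₁₃² − σ₁₂σ₃₃σ₁₄ + σ₁₁σ₃₃σ₂₄ + σ₁₂σ₁₃σ₃₄ − σ₁₁σ₂₃σ₃₄, and let I = ⟨p₁,p₂⟩. Then the symmetry Lie algebra of I, namely { g ∈ M₁₀(ℂ) : g∗p_i ∈ span_ℂ{p₁,p₂} for i = 1,2 }, is a complex vector space of dimension 4. (Since I is prime of dimension 8 > 4, the vanishing ideal of the Gaussian graphical model of the four-cycle is not toric under any linear change of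 variables.) -/
noncomputable section
open MvPolynomial

/-- `p₁ = σ₂₃σ₁₄σ₂₄ − σ₁₃σ₂₄² − σ₂₂σ₁₄σ₃₄ + σ₁₂σ₂₄σ₃₄ + σ₂₂σ₁₃σ₄₄ − σ₁₂σ₂₃σ₄₄`, with the ten
variables ordered `σ₁₁,σ₁₂,σ₁₃,σ₁₄,σ₂₂,σ₂₃,σ₂₄,σ₃₃,σ₃₄,σ₄₄` as `X 0,…,X 9`. -/
def pG1 : MvPolynomial (Fin 10) ℂ :=
  X 5 * X 3 * X 6 - X 2 * X 6 ^ 2 - X 4 * X 3 * X 8 + X 1 * X 6 * X 8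
    + X 4 * X 2 * X 9 - X 1 * X 5 * X 9

/-- `p₂ = σ₁₃σ₂₃σ₁₄ − σ₂₄σ₁₃² − σ₁₂σ₃₃σ₁₄ + σ₁₁σ₃₃σ₂₄ + σ₁₂σ₁₃σ₃₄ − σ₁₁σ₂₃σ₃₄`. -/
def pG2 : MvPolynomial (Fin 10) ℂ :=
  X 2 * X 5 * X 3 - X 6 * X 2 ^ 2 - X 1 * X 7 * X 3 + X 0 * X 7 * X 6
    + X 1 * X 2 * X 8 - X 0 * X 5 * X 8

set_option linter.all false

/-- Full polarization of the monomial `x_a x_b x_c`. -/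
def polMon {R : Type} [CommRing R] (x y z : Fin 10 → R) (a b c : Fin 10) : R :=
  x a * y b * z c + x a * z b * y c + y a * x b * z c + y a * z b * x c + z a * x b * y c
    + z a * y b * x c

/-- Full polarization of `p₁` (`true`) and `p₂` (`false`). -/
def tri {R : Type} [CommRing R] (k : Bool) (x y z : Fin 10 → R) : R :=
  match k with
  | true => polMon x y z 5 3 6 - polMon x y z 2 6 6 - polMon x y z 4 3 8 + polMon x y z 1 6 8
      + polMon x y z 4 2 9 - polMon x y z 1 5 9
  | false => polMon x y z 2 5 3 - polMon x y z 6 2 2 - polMon x y z 1 7 3 + polMon x y z 0 7 6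
      + polMon x y z 1 2 8 - polMon x y z 0 5 8

/-- Basis vectors. -/
def bv {R : Type} [CommRing R] (a : Fin 10) : Fin 10 → R := fun l => if l = a then 1 else 0

/-- The integer coefficient tensor. -/
def ten (k : Bool) (a b c : Fin 10) : ℤ := tri k (bv a) (bv b) (bv c)

theorem polMon_add {R : Type} [CommRing R] (x u y z : Fin 10 → R) (a b c : Fin 10) :
    polMon (x + u) y z a b c = polMon x y z a b c + polMon u y z a b c := by
  simp only [polMon, Pi.add_apply]; ring

theorem polMon_sw12 {R : Type} [CommRing R] (x y z : Fin 10 → R) (a b c : Fin 10) :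
    polMon x y z a b c = polMon y x z a b c := by
  simp only [polMon]; ring

theorem polMon_sw23 {R : Type} [CommRing R] (x y z : Fin 10 → R) (a b c : Fin 10) :
    polMon x y z a b c = polMon x z y a b c := by
  simp only [polMon]; ring

theorem tri_add {R : Type} [CommRing R] (k : Bool) (x u y z : Fin 10 → R) :
    tri k (x + u) y z = tri k x y z + tri k u y z := by
  cases k <;> simp only [tri, polMon_add] <;> ring

theorem tri_sw12 {R : Type} [CommRing R] (k : Bool) (x y z : Fin 10 → R) :
    tri k x y z = tri k y x z := by
  cases k <;> simp only [tri, polMon_sw12 x y z]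

theorem tri_sw23 {R : Type} [CommRing R] (k : Bool) (x y z : Fin 10 → R) :
    tri k x y z = tri k x z y := by
  cases k <;> simp only [tri, polMon_sw23 x y z]

theorem tri_add2 {R : Type} [CommRing R] (k : Bool) (x u y z : Fin 10 → R) :
    tri k y (x + u) z = tri k y x z + tri k y u z := by
  rw [tri_sw12, tri_add, tri_sw12 k x, tri_sw12 k u]

theorem tri_add3 {R : Type} [CommRing R] (k : Bool) (x u y z : Fin 10 → R) :
    tri k y z (x + u) = tri k y z x + tri k y z u := by
  rw [tri_sw23, tri_add2, tri_sw23 k y x, tri_sw23 k y u]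

theorem polMon_expand {R : Type} [CommRing R] (w y z : Fin 10 → R) (a b c : Fin 10) :
    polMon w y z a b c = ∑ i, w i * polMon (bv i) y z a b c := by
  have h (d : Fin 10) (r : R) : ∑ i, w i * (bv i d * r) = w d * r := by
    simp [bv]
  have e : ∀ i, w i * polMon (bv i) y z a b c =
      w i * (bv i a * (y b * z c + z b * y c)) + w i * (bv i b * (y a * z c + z a * y c))
      + w i * (bv i c * (y a * z b + z a * y b)) := by
    intro i; simp only [polMon]; ring
  simp only [e, Finset.sum_add_distrib, h]
  simp only [polMon]; ring

theorem tri_expand {R : Type} [CommRing R] (k : Bool) (w y z : Fin 10 → R) :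
    tri k w y z = ∑ i, w i * tri k (bv i) y z := by
  cases k <;> simp only [tri, mul_add, mul_sub, Finset.sum_add_distrib, Finset.sum_sub_distrib,
    ← polMon_expand]

theorem bv_cast (a l : Fin 10) : (bv a l : ℂ) = ((bv a l : ℤ) : ℂ) := by
  simp only [bv]; split_ifs <;> simp

theorem ten_cast (k : Bool) (a b c : Fin 10) :
    tri k (bv a) (bv b) (bv c) = ((ten k a b c : ℤ) : ℂ) := by
  cases k <;> simp only [ten, tri, polMon, bv_cast] <;> push_cast <;> rfl

/-- The polynomials as a family. -/
def pp (k : Bool) : MvPolynomial (Fin 10) ℂ := if k then pG1 else pG2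

theorem eval_pp (k : Bool) (v : Fin 10 → ℂ) : 6 * eval v (pp k) = tri k v v v := by
  cases k <;> simp [pp, pG1, pG2, tri, polMon] <;> ring

theorem eval_starAct (g : Matrix (Fin 10) (Fin 10) ℂ) (k : Bool) (v : Fin 10 → ℂ) :
    2 * eval v (starAct g (pp k)) = - tri k (g.mulVec v) v v := by
  have h : eval v (starAct g (pp k)) = - ∑ i, g.mulVec v i * eval v (pderiv i (pp k)) := by
    simp only [starAct, map_sum, smul_eval, map_mul, eval_X, Matrix.mulVec, dotProduct,
      Finset.sum_mul, ← Finset.sum_neg_distrib]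
    refine Finset.sum_congr rfl fun i _ => Finset.sum_congr rfl fun j _ => ?_
    ring
  have h2 : ∀ i, 2 * eval v (pderiv i (pp k)) = tri k (bv i) v v := by
    intro i
    cases k <;>
    simp only [pp, pG1, pG2, tri, polMon, bv, map_add, map_sub, Derivation.leibniz,
      Derivation.leibniz_pow, pderiv_X, smul_eq_mul, map_mul, eval_X, map_pow, Pi.single_apply,
      if_true, if_false, Bool.false_eq_true, nsmul_eq_mul, apply_ite (eval v), map_one, map_zero,
      map_natCast] <;> push_cast <;> ring
  rw [h, tri_expand]
  simp only [← h2, mul_neg, Finset.mul_sum]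
  congr 1
  refine Finset.sum_congr rfl fun i _ => ?_
  ring

theorem polarize (g : Matrix (Fin 10) (Fin 10) ℂ) (k : Bool) (A B : ℂ)
    (h : ∀ v, 3 * tri k (g.mulVec v) v v = A * tri true v v v + B * tri false v v v)
    (x y z : Fin 10 → ℂ) :
    tri k (g.mulVec x) y z + tri k (g.mulVec y) x z + tri k (g.mulVec z) x y
      = A * tri true x y z + B * tri false x y z := by
  have h1 := h x
  have h2 := h y
  have h3 := h z
  have h4 := h (x + y)
  have h5 := h (x + z)
  have h6 := h (y + z)
  have h7 := h (x + y + z)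
  simp only [Matrix.mulVec_add, tri_add, tri_add2, tri_add3] at h4 h5 h6 h7
  have s1 (k : Bool) (w : Fin 10 → ℂ) : tri k w y x = tri k w x y := tri_sw23 ..
  have s2 (k : Bool) (w : Fin 10 → ℂ) : tri k w z x = tri k w x z := tri_sw23 ..
  have s3 (k : Bool) (w : Fin 10 → ℂ) : tri k w z y = tri k w y z := tri_sw23 ..
  have s4 (k : Bool) (w : Fin 10 → ℂ) : tri k y x w = tri k x y w := tri_sw12 ..
  have s5 (k : Bool) (w : Fin 10 → ℂ) : tri k z x w = tri k x z w := tri_sw12 ..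
  have s6 (k : Bool) (w : Fin 10 → ℂ) : tri k z y w = tri k y z w := tri_sw12 ..
  simp only [s1, s2, s3, s4, s5, s6] at h4 h5 h6 h7
  linear_combination (h7 - h4 - h5 - h6 + h1 + h2 + h3) / 6

theorem mulVec_bv (g : Matrix (Fin 10) (Fin 10) ℂ) (a : Fin 10) :
    g.mulVec (bv a) = fun i => g i a := by
  funext i; simp [Matrix.mulVec, dotProduct, bv]

/-- Coefficient of `g i j` in the coefficient of `x_a x_b x_c` of `g * p_k`. -/
def cf (k : Bool) (a b c i j : Fin 10) : ℤ :=
  (if j = a then ten k i b c else 0) + (if j = b then ten k i a c else 0)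
    + (if j = c then ten k i a b else 0)

theorem eqn (g : Matrix (Fin 10) (Fin 10) ℂ) (k : Bool)
    (hg : starAct g (pp k) ∈ Submodule.span ℂ {pG1, pG2}) :
    ∃ A B : ℂ, ∀ a b c, ∑ i, ∑ j, (cf k a b c i j : ℂ) * g i j
      = A * (ten true a b c : ℂ) + B * (ten false a b c : ℂ) := by
  obtain ⟨A, B, h⟩ := Submodule.mem_span_pair.1 hg
  refine ⟨-A, -B, fun a b c => ?_⟩
  have key := polarize g k (-A) (-B) (fun v => by
    have e := congrArg (eval v) h
    simp only [map_add, smul_eval] at e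
    have e1 := eval_pp true v
    have e2 := eval_pp false v
    have e3 := eval_starAct g k v
    simp only [pp, if_true, Bool.false_eq_true, if_false] at e1 e2
    rw [← e1, ← e2]
    linear_combination 6 * e + 3 * e3) (bv a) (bv b) (bv c)
  rw [mulVec_bv, mulVec_bv, mulVec_bv, tri_expand k (fun i => g i a),
    tri_expand k (fun i => g i b), tri_expand k (fun i => g i c)] at key
  simp only [ten_cast] at key
  rw [← key, ← Finset.sum_add_distrib, ← Finset.sum_add_distrib]
  refine Finset.sum_congr rfl fun i _ => ?_
  simp only [cf, Int.cast_add, Int.cast_ite, Int.cast_zero, add_mul, ite_mul, zero_mul,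
    Finset.sum_add_distrib, Finset.sum_ite_eq', Finset.sum_ite_eq, Finset.mem_univ, if_true]
  ring

/-- Certificates `(k, i, j, a, b, c)`: the coefficient of `x_a x_b x_c` in `g * p_k` only involves
`g i j`. -/
def cert1 : List (Bool × Fin 10 × Fin 10 × Fin 10 × Fin 10 × Fin 10) :=
  [(false, 0, 4, 4, 6, 7), (false, 0, 5, 5, 6, 7), (false, 0, 6, 6, 6, 7), (false, 0, 7, 6, 7, 7),
   (false, 0, 8, 6, 7, 8), (false, 0, 9, 6, 7, 9), (true, 1, 0, 0, 6, 8), (false, 1, 3, 3, 3, 7),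
   (false, 1, 4, 3, 4, 7), (true, 1, 5, 5, 5, 9), (true, 1, 7, 6, 7, 8), (true, 1, 8, 6, 8, 8),
   (true, 1, 9, 6, 8, 9), (true, 2, 0, 0, 6, 6), (false, 2, 1, 1, 1, 8), (false, 2, 3, 3, 3, 5),
   (true, 2, 4, 4, 6, 6), (false, 2, 5, 3, 5, 5), (true, 2, 6, 6, 6, 6), (true, 2, 7, 6, 6, 7),
   (false, 2, 8, 1, 8, 8), (true, 2, 9, 6, 6, 9), (true, 3, 0, 0, 5, 6), (false, 3, 1, 1, 1, 7),
   (true, 3, 4, 4, 5, 6), (true, 3, 5, 5, 5, 6), (true, 3, 7, 5, 6, 7), (true, 3, 8, 4, 8, 8),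
   (false, 3, 9, 2, 5, 9), (true, 4, 0, 0, 3, 8), (true, 4, 2, 2, 3, 8), (true, 4, 3, 3, 3, 8),
   (true, 4, 7, 3, 7, 8), (true, 4, 8, 3, 8, 8), (true, 4, 9, 3, 8, 9), (true, 5, 0, 0, 3, 6),
   (true, 5, 1, 1, 1, 9), (true, 5, 3, 3, 3, 6), (false, 5, 4, 2, 3, 4), (true, 5, 7, 3, 6, 7),
   (false, 5, 8, 0, 8, 8), (true, 5, 9, 3, 6, 9), (true, 6, 0, 0, 3, 5), (true, 6, 1, 1, 1, 8),
   (false, 6, 2, 2, 2, 2), (true, 6, 3, 3, 3, 5), (false, 6, 4, 2, 2, 4), (true, 6, 5, 3, 5, 5),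
   (true, 6, 7, 3, 5, 7), (true, 6, 8, 1, 8, 8), (false, 6, 9, 2, 2, 9), (false, 7, 0, 0, 1, 3),
   (false, 7, 1, 1, 1, 3), (false, 7, 3, 1, 3, 3), (false, 7, 4, 1, 3, 4), (false, 7, 6, 1, 3, 6),
   (false, 7, 9, 1, 3, 9), (true, 8, 0, 0, 3, 4), (true, 8, 1, 1, 3, 4), (true, 8, 3, 3, 3, 4),
   (true, 8, 4, 3, 4, 4), (false, 8, 5, 0, 5, 5), (true, 8, 7, 3, 4, 7), (false, 8, 9, 1, 2, 9),
   (true, 9, 0, 0, 2, 4), (true, 9, 1, 1, 2, 4), (true, 9, 2, 2, 2, 4), (true, 9, 4, 2, 4, 4),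
   (true, 9, 5, 2, 4, 5), (true, 9, 7, 2, 4, 7)]

/-- Certificates `(k, i, j, a, b, c)`: the coefficient of `x_a x_b x_c` in `g * p_k` only involves
`g i j` and entries already known to vanish. -/
def cert2 : List (Bool × Fin 10 × Fin 10 × Fin 10 × Fin 10 × Fin 10) :=
  [(false, 0, 1, 1, 5, 8), (false, 0, 2, 2, 5, 8), (false, 0, 3, 3, 5, 8), (true, 1, 2, 2, 6, 8),
   (true, 1, 6, 5, 6, 9), (true, 3, 2, 2, 5, 6), (true, 3, 6, 5, 6, 6), (true, 4, 1, 1, 3, 8),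
   (true, 4, 5, 3, 5, 8), (true, 4, 6, 3, 6, 8), (true, 5, 2, 2, 3, 6), (true, 5, 6, 3, 6, 6),
   (false, 7, 2, 1, 2, 3), (false, 7, 5, 1, 3, 5), (false, 7, 8, 1, 3, 8), (true, 8, 2, 1, 2, 6),
   (true, 8, 6, 3, 4, 6), (true, 9, 3, 1, 3, 5), (true, 9, 6, 1, 5, 6), (true, 9, 8, 1, 5, 8)]

/-- Validity of a certificate relative to a list of certificates already established. -/
def validB (S : List (Bool × Fin 10 × Fin 10 × Fin 10 × Fin 10 × Fin 10))
    (e : Bool × Fin 10 × Fin 10 × Fin 10 × Fin 10 × Fin 10) : Bool :=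
  match e with
  | (k, i, j, a, b, c) => !(cf k a b c i j == 0) && (ten true a b c == 0) &&
      (ten false a b c == 0) && (List.finRange 10).all fun i2 => (List.finRange 10).all fun j2 =>
        (i2 == i && j2 == j) || (cf k a b c i2 j2 == 0) ||
          S.any fun s => s.2.1 == i2 && s.2.2.1 == j2

/-- Propositional version of `validB`. -/
def valid (S : List (Bool × Fin 10 × Fin 10 × Fin 10 × Fin 10 × Fin 10))
    (e : Bool × Fin 10 × Fin 10 × Fin 10 × Fin 10 × Fin 10) : Prop :=
  match e with
  | (k, i, j, a, b, c) => cf k a b c i j ≠ 0 ∧ ten true a b c = 0 ∧ ten false a b c = 0 ∧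
      ∀ i2 j2, (i2 = i ∧ j2 = j) ∨ cf k a b c i2 j2 = 0 ∨ ∃ s ∈ S, s.2.1 = i2 ∧ s.2.2.1 = j2

theorem valid_of (S : List (Bool × Fin 10 × Fin 10 × Fin 10 × Fin 10 × Fin 10))
    (L : List (Bool × Fin 10 × Fin 10 × Fin 10 × Fin 10 × Fin 10))
    (h : L.all (validB S) = true) : ∀ e ∈ L, valid S e := by
  intro e he
  have h := List.all_eq_true.1 h e he
  obtain ⟨k, i, j, a, b, c⟩ := e
  simp only [validB, Bool.and_eq_true, Bool.not_eq_true', beq_eq_false_iff_ne, beq_iff_eq,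
    List.all_eq_true, Bool.or_eq_true, List.any_eq_true, List.mem_finRange, forall_const,
    or_assoc, and_assoc] at h
  exact h

theorem cert1_valid : ∀ e ∈ cert1, valid [] e :=
  valid_of _ _ (by decide +kernel)

theorem cert2_valid : ∀ e ∈ cert2, valid cert1 e :=
  valid_of _ _ (by decide +kernel)

theorem cert_complete : ∀ i j : Fin 10, i ≠ j → ∃ s ∈ cert1 ++ cert2, s.2.1 = i ∧ s.2.2.1 = j := by
  decide +kernel

theorem vanish (g : Matrix (Fin 10) (Fin 10) ℂ)
    (hg : ∀ k, starAct g (pp k) ∈ Submodule.span ℂ {pG1, pG2})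
    (S : List (Bool × Fin 10 × Fin 10 × Fin 10 × Fin 10 × Fin 10))
    (hS : ∀ s ∈ S, g s.2.1 s.2.2.1 = 0)
    (e : Bool × Fin 10 × Fin 10 × Fin 10 × Fin 10 × Fin 10) (he : valid S e) :
    g e.2.1 e.2.2.1 = 0 := by
  obtain ⟨k, i, j, a, b, c⟩ := e
  obtain ⟨h0, h1, h2, h3⟩ := he
  obtain ⟨A, B, h⟩ := eqn g k (hg k)
  have h := h a b c
  rw [h1, h2, Finset.sum_eq_single i, Finset.sum_eq_single j] at h
  · have : (cf k a b c i j : ℂ) ≠ 0 := by exact_mod_cast h0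
    simpa [this] using h
  · intro j2 _ hj
    rcases h3 i j2 with h | h | ⟨s, hs, rfl, rfl⟩
    · exact absurd h.2 hj
    · simp [h]
    · simp [hS s hs]
  · simp
  · intro i2 _ hi
    refine Finset.sum_eq_zero fun j2 _ => ?_
    rcases h3 i2 j2 with h | h | ⟨s, hs, rfl, rfl⟩
    · exact absurd h.1 hi
    · simp [h]
    · simp [hS s hs]
  · simp

theorem offdiag (g : Matrix (Fin 10) (Fin 10) ℂ)
    (hg : ∀ k, starAct g (pp k) ∈ Submodule.span ℂ {pG1, pG2}) (i j : Fin 10) (hij : i ≠ j) :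
    g i j = 0 := by
  have c1 : ∀ s ∈ cert1, g s.2.1 s.2.2.1 = 0 := fun s hs =>
    vanish g hg [] (by simp) s (cert1_valid s hs)
  have c2 : ∀ s ∈ cert2, g s.2.1 s.2.2.1 = 0 := fun s hs =>
    vanish g hg cert1 c1 s (cert2_valid s hs)
  obtain ⟨s, hs, rfl, rfl⟩ := cert_complete i j hij
  rcases List.mem_append.1 hs with h | h
  · exact c1 s h
  · exact c2 s h

theorem ondiag (g : Matrix (Fin 10) (Fin 10) ℂ)
    (hg : ∀ k, starAct g (pp k) ∈ Submodule.span ℂ {pG1, pG2}) (k : Bool) :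
    ∃ C : ℂ, ∀ a b c, ten k a b c ≠ 0 → ten (!k) a b c = 0 → g a a + g b b + g c c = C := by
  obtain ⟨A, B, h⟩ := eqn g k (hg k)
  refine ⟨if k then A else B, fun a b c h0 h1 => ?_⟩
  have h := h a b c
  have e : ∀ i, ∑ j, (cf k a b c i j : ℂ) * g i j = (cf k a b c i i : ℂ) * g i i := by
    intro i
    refine Finset.sum_eq_single i (fun j _ hj => ?_) (by simp)
    rw [offdiag g hg i j hj.symm, mul_zero]
  have p1 : ten k b a c = ten k a b c := tri_sw12 ..
  have p2 : ten k c a b = ten k a b c := by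
    unfold ten; rw [tri_sw12, tri_sw23]
  simp only [e] at h
  simp only [cf, Int.cast_add, Int.cast_ite, Int.cast_zero, add_mul, ite_mul, zero_mul,
    Finset.sum_add_distrib, Finset.sum_ite_eq', Finset.sum_ite_eq, Finset.mem_univ, if_true,
    p1, p2] at h
  have h0' : (ten k a b c : ℂ) ≠ 0 := by exact_mod_cast h0
  apply mul_left_cancel₀ h0'
  cases k <;> simp only [Bool.not_true, Bool.not_false] at h1 <;> rw [h1] at h <;>
    simp only [Int.cast_zero, if_true, if_false, Bool.false_eq_true] <;> linear_combination h

/-- The torus: `σ_ij` has weight `t_i + t_j`. -/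
def wt : (Fin 4 → ℂ) →ₗ[ℂ] (Fin 10 → ℂ) where
  toFun t := ![t 0 + t 0, t 0 + t 1, t 0 + t 2, t 0 + t 3, t 1 + t 1, t 1 + t 2, t 1 + t 3,
    t 2 + t 2, t 2 + t 3, t 3 + t 3]
  map_add' s t := by
    funext i; fin_cases i <;> simp <;> ring
  map_smul' s t := by
    funext i; fin_cases i <;> simp <;> ring

/-- The torus inside the matrices. -/
def torus : (Fin 4 → ℂ) →ₗ[ℂ] Matrix (Fin 10) (Fin 10) ℂ :=
  (Matrix.diagonalLinearMap (Fin 10) ℂ ℂ).comp wt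

theorem torus_inj : Function.Injective torus := by
  intro s t h
  have h' : wt s = wt t := Matrix.diagonal_injective h
  have h0 := congrFun h' 0
  have h4 := congrFun h' 4
  have h7 := congrFun h' 7
  have h9 := congrFun h' 9
  simp only [wt, LinearMap.coe_mk, AddHom.coe_mk] at h0 h4 h7 h9
  simp at h0 h4 h7 h9
  funext i
  fin_cases i <;> simp <;> grind

theorem starAct_diag (d : Fin 10 → ℂ) (p : MvPolynomial (Fin 10) ℂ) :
    starAct (Matrix.diagonal d) p = ∑ i, C (-(d i)) * (X i * pderiv i p) := by
  unfold starAct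
  refine Finset.sum_congr rfl fun i _ => ?_
  rw [Finset.sum_eq_single i]
  · rw [Matrix.diagonal_apply_eq, smul_eq_C_mul]
  · intro j _ hj
    rw [Matrix.diagonal_apply_ne _ hj.symm]; simp
  · simp

theorem torus_mem1 (t : Fin 4 → ℂ) :
    starAct (torus t) pG1 = (-(t 0 + (t 1 + t 1) + t 2 + (t 3 + t 3))) • pG1 := by
  have : torus t = Matrix.diagonal (wt t) := rfl
  rw [this, starAct_diag, smul_eq_C_mul]
  simp only [Fin.sum_univ_succ, wt, pG1]
  simp [pderiv_X, Pi.single_apply, Fin.ext_iff]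
  ring

theorem torus_mem2 (t : Fin 4 → ℂ) :
    starAct (torus t) pG2 = (-((t 0 + t 0) + t 1 + (t 2 + t 2) + t 3)) • pG2 := by
  have : torus t = Matrix.diagonal (wt t) := rfl
  rw [this, starAct_diag, smul_eq_C_mul]
  simp only [Fin.sum_univ_succ, wt, pG2]
  simp [pderiv_X, Pi.single_apply, Fin.ext_iff]
  ring

theorem mem_torus (g : Matrix (Fin 10) (Fin 10) ℂ)
    (hg : ∀ k, starAct g (pp k) ∈ Submodule.span ℂ {pG1, pG2}) : g ∈ LinearMap.range torus := by
  obtain ⟨A, hA⟩ := ondiag g hg true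
  obtain ⟨B, hB⟩ := ondiag g hg false
  have a1 := hA 5 3 6 (by decide +kernel) (by decide +kernel)
  have a2 := hA 2 6 6 (by decide +kernel) (by decide +kernel)
  have a3 := hA 4 3 8 (by decide +kernel) (by decide +kernel)
  have a4 := hA 1 6 8 (by decide +kernel) (by decide +kernel)
  have a5 := hA 4 2 9 (by decide +kernel) (by decide +kernel)
  have a6 := hA 1 5 9 (by decide +kernel) (by decide +kernel)
  have b1 := hB 2 5 3 (by decide +kernel) (by decide +kernel)
  have b2 := hB 6 2 2 (by decide +kernel) (by decide +kernel)
  have b3 := hB 1 7 3 (by decide +kernel) (by decide +kernel)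
  have b4 := hB 0 7 6 (by decide +kernel) (by decide +kernel)
  have b5 := hB 1 2 8 (by decide +kernel) (by decide +kernel)
  have b6 := hB 0 5 8 (by decide +kernel) (by decide +kernel)
  refine ⟨![g 0 0 / 2, g 4 4 / 2, g 7 7 / 2, g 9 9 / 2], ?_⟩
  have hw : wt ![g 0 0 / 2, g 4 4 / 2, g 7 7 / 2, g 9 9 / 2] = fun i => g i i := by
    clear hA hB
    funext i
    fin_cases i <;> simp [wt] <;> grind
  ext i j
  change Matrix.diagonal (wt _) i j = _
  rw [hw]
  by_cases hij : i = j
  · subst hij; simp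
  · rw [Matrix.diagonal_apply_ne _ hij, offdiag g hg i j hij]

/-- The symmetry Lie algebra
`{g ∈ M₁₀(ℂ) : g ∗ pᵢ ∈ span_ℂ{p₁,p₂} for i = 1,2}` of the vanishing ideal `I = ⟨p₁,p₂⟩` of the
Gaussian graphical model of the four-cycle is a complex vector space of dimension `4`. -/
theorem fourCycle_lieAlg_dim_four :
    ∃ W : Submodule ℂ (Matrix (Fin 10) (Fin 10) ℂ),
      (W : Set (Matrix (Fin 10) (Fin 10) ℂ)) =
        {g | starAct g pG1 ∈ Submodule.span ℂ {pG1, pG2} ∧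
             starAct g pG2 ∈ Submodule.span ℂ {pG1, pG2}} ∧
      Module.finrank ℂ W = 4 := by
  refine ⟨LinearMap.range torus, ?_, ?_⟩
  · ext g
    constructor
    · rintro ⟨t, rfl⟩
      refine ⟨?_, ?_⟩
      · rw [torus_mem1]
        exact Submodule.smul_mem _ _ (Submodule.subset_span (by simp))
      · rw [torus_mem2]
        exact Submodule.smul_mem _ _ (Submodule.subset_span (by simp))
    · rintro ⟨h1, h2⟩
      refine mem_torus g fun k => ?_
      cases k
      · exact h2
      · exact h1
  · rw [LinearMap.finrank_range_of_inj torus_inj]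
    simp
end
end
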